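/- arXiv:1411.1506 — 4 statements merged into one kernel-verified Lean document; each statement's English description precedes it below -/
import Mathlib

section
/- For all integers m ≥ 5 and m' ≥ 7, the groups ⧈(m,2) and Δ(m',2) are abstractly commensurable. -/
/-- Entry of a path-diagram Coxeter matrix; `a` and `b` stand for the min and max
of the two indices. The label of the edge `{0,1}` is `m`, all other edges are labelled `3`,
and non-adjacent pairs of nodes get the label `2`. -/
def simplexEntry (m a b : ℕ) : ℕ :=
  if a = b then 1 else if b = a + 1 then (if a = 0 then m else 3) else 2

/-- The Coxeter matrix of the superideal simplex group `Δ(m,d)`: a path diagram on the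
`d+1` nodes `0,…,d`, with the edge `{0,1}` labelled `m` and all other edges labelled `3`. -/
def simplexMatrix (m d : ℕ) (hm : 3 ≤ m) : CoxeterMatrix (Fin (d + 1)) where
  M := Matrix.of fun i j => simplexEntry m (min i.val j.val) (max i.val j.val)
  isSymm := by
    ext i j
    simp only [Matrix.transpose_apply, Matrix.of_apply, Nat.min_comm, Nat.max_comm]
  diagonal i := by simp [simplexEntry]
  off_diagonal i j h := by
    have hij : i.val ≠ j.val := fun hc => h (Fin.ext hc)
    simp only [Matrix.of_apply, simplexEntry]
    split_ifs <;> omega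

/-- The superideal simplex group `Δ(m,d)`. -/
abbrev simplexGroup (m d : ℕ) (hm : 3 ≤ m) : Type := (simplexMatrix m d hm).Group

/-- Entry of the path-diagram Coxeter matrix of the superideal cube group;
`a` and `b` stand for the min and max of the two indices.  The edge `{0,1}` is labelled `m`,
the edge `{d-1,d}` is labelled `4`, all other edges are labelled `3`, and non-adjacent
pairs of nodes get the label `2`. -/
def cubeEntry (m d a b : ℕ) : ℕ :=
  if a = b then 1 else
    if b = a + 1 then (if a = 0 then m else if b = d then 4 else 3) else 2

/-- The Coxeter matrix of the superideal cube group `⧈(m,d)`: a path diagram on the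
`d+1` nodes `0,…,d`, with the edge `{0,1}` labelled `m`, the edge `{d-1,d}` labelled `4`,
and all other edges labelled `3`. -/
def cubeMatrix (m d : ℕ) (hm : 3 ≤ m) : CoxeterMatrix (Fin (d + 1)) where
  M := Matrix.of fun i j => cubeEntry m d (min i.val j.val) (max i.val j.val)
  isSymm := by
    ext i j
    simp only [Matrix.transpose_apply, Matrix.of_apply, Nat.min_comm, Nat.max_comm]
  diagonal i := by simp [cubeEntry]
  off_diagonal i j h := by
    have hij : i.val ≠ j.val := fun hc => h (Fin.ext hc)
    simp only [Matrix.of_apply, cubeEntry]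
    split_ifs <;> omega

/-- The superideal cube group `⧈(m,d)`. -/
abbrev cubeGroup (m d : ℕ) (hm : 3 ≤ m) : Type := (cubeMatrix m d hm).Group

/-- Two groups are abstractly commensurable if they have isomorphic finite-index subgroups. -/
def AbstractlyCommensurable (G H : Type*) [Group G] [Group H] : Prop :=
  ∃ (G' : Subgroup G) (H' : Subgroup H),
    G'.FiniteIndex ∧ H'.FiniteIndex ∧ Nonempty (G' ≃* H')

namespace AbstractlyCommensurable

theorem symm {G H : Type*} [Group G] [Group H] (h : AbstractlyCommensurable G H) :
    AbstractlyCommensurable H G := by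
  obtain ⟨G', H', hG, hH, ⟨e⟩⟩ := h
  exact ⟨H', G', hH, hG, ⟨e.symm⟩⟩

theorem of_injective {L G H : Type*} [Group L] [Group G] [Group H] (f : L →* G) (g : L →* H)
    (hf : Function.Injective f) (hg : Function.Injective g)
    (hf' : f.range.FiniteIndex) (hg' : g.range.FiniteIndex) : AbstractlyCommensurable G H :=
  ⟨f.range, g.range, hf', hg',
    ⟨(MonoidHom.ofInjective hf).symm.trans (MonoidHom.ofInjective hg)⟩⟩

theorem of_injective_left {K G : Type*} [Group K] [Group G] {f : K →* G}
    (h : Function.Injective f ∧ f.range.FiniteIndex) : AbstractlyCommensurable G K := by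
  refine of_injective f (MonoidHom.id K) h.1 Function.injective_id h.2 ?_
  rw [MonoidHom.range_eq_top.2 Function.surjective_id]
  infer_instance

theorem finiteIndex_map {L G : Type*} [Group L] [Group G] {f : L →* G}
    (hf : Function.Injective f) (hf' : f.range.FiniteIndex) (A : Subgroup L) [A.FiniteIndex] :
    (A.map f).FiniteIndex := by
  refine ⟨?_⟩
  rw [Subgroup.index_map, (MonoidHom.ker_eq_bot_iff f).2 hf, sup_bot_eq]
  exact mul_ne_zero Subgroup.FiniteIndex.index_ne_zero hf'.index_ne_zero

theorem injective_subtype_comp {A J : Type*} [Group A] [Group J] {B : Subgroup A} (e : J ≃* B) :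
    Function.Injective (B.subtype.comp e.toMonoidHom) := fun _ _ h =>
  e.injective (Subtype.ext h)

theorem finiteIndex_range_comp_inclusion {A H : Type*} [Group A] [Group H] {B : Subgroup A}
    (hB : B.FiniteIndex) {I J : Subgroup H} (hI : I.FiniteIndex) (h : I ≤ J) (e : J ≃* B) :
    ((B.subtype.comp e.toMonoidHom).comp (Subgroup.inclusion h)).range.FiniteIndex := by
  rw [MonoidHom.range_comp, Subgroup.inclusion_range]
  refine finiteIndex_map (injective_subtype_comp e) ?_ _
  rw [MonoidHom.range_comp, MonoidHom.range_eq_top.2 e.surjective, ← MonoidHom.range_eq_map,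
    Subgroup.range_subtype]
  exact hB

theorem trans {G H K : Type*} [Group G] [Group H] [Group K] (h₁ : AbstractlyCommensurable G H)
    (h₂ : AbstractlyCommensurable H K) : AbstractlyCommensurable G K := by
  obtain ⟨G₁, H₁, hG₁, hH₁, ⟨e₁⟩⟩ := h₁
  obtain ⟨H₂, K₂, hH₂, hK₂, ⟨e₂⟩⟩ := h₂
  have hI : (H₁ ⊓ H₂).FiniteIndex := inferInstance
  exact of_injective ((G₁.subtype.comp e₁.symm.toMonoidHom).comp
    (Subgroup.inclusion (inf_le_left : H₁ ⊓ H₂ ≤ H₁)))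
    ((K₂.subtype.comp e₂.toMonoidHom).comp (Subgroup.inclusion inf_le_right))
    (fun _ _ h => Subgroup.inclusion_injective _ (injective_subtype_comp e₁.symm h))
    (fun _ _ h => Subgroup.inclusion_injective _ (injective_subtype_comp e₂ h))
    (finiteIndex_range_comp_inclusion hG₁ hI _ _) (finiteIndex_range_comp_inclusion hK₂ hI _ _)

end AbstractlyCommensurable

open scoped Pointwise in
/-- A homomorphism `ψ : K → G` is an embedding onto a finite-index subgroup as soon as `G` acts on
`X × K` in such a way that `ψ k` translates the base fibre by `k`, and finitely many cosets of the
image are permuted by the generators of `G`. -/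
theorem injective_and_finiteIndex_range_of_action {G K X : Type*} [Group G] [Group K] [Finite X]
    (ψ : K →* G) (ρ : G →* Equiv.Perm (X × K)) (x₀ : X) (t : X → G) {SK : Set K} {SG : Set G}
    (hSK : Subgroup.closure SK = ⊤) (hSG : Subgroup.closure SG = ⊤)
    (hρ : ∀ k ∈ SK, ∀ k', ρ (ψ k) (x₀, k') = (x₀, k * k')) (ht : t x₀ = 1)
    (hfin : ∀ s ∈ SG, ∀ x, ∃ x', (t x')⁻¹ * (s * t x) ∈ ψ.range) :
    Function.Injective ψ ∧ ψ.range.FiniteIndex := by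
  constructor
  · have hall : ∀ k k', ρ (ψ k) (x₀, k') = (x₀, k * k') := by
      intro k
      have hk : k ∈ Subgroup.closure SK := hSK ▸ Subgroup.mem_top k
      induction hk using Subgroup.closure_induction with
      | mem k hk => exact hρ k hk
      | one => simp
      | mul a b _ _ ha hb =>
        intro k'
        rw [map_mul, map_mul, Equiv.Perm.mul_apply, hb, ha, mul_assoc]
      | inv a _ ha =>
        intro k'
        rw [map_inv, map_inv, Equiv.Perm.inv_eq_iff_eq, ha, mul_inv_cancel_left]
    intro k k' h
    have h1 := hall k 1
    rw [h, hall] at h1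
    simpa using h1.symm
  · let U : Set (G ⧸ ψ.range) := Set.range fun x => (t x : G ⧸ ψ.range)
    have hU : U.Finite := Set.finite_range _
    have hstab : MulAction.stabilizer G U = ⊤ := by
      rw [eq_top_iff, ← hSG, Subgroup.closure_le]
      intro s hs
      rw [SetLike.mem_coe, MulAction.mem_stabilizer_set_iff_smul_set_subset hU]
      rintro _ ⟨_, ⟨x, rfl⟩, rfl⟩
      obtain ⟨x', hx'⟩ := hfin s hs x
      exact ⟨x', QuotientGroup.eq.2 hx'⟩
    have htop : U = Set.univ := by
      refine Set.eq_univ_of_forall fun q => ?_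
      obtain ⟨g, rfl⟩ := QuotientGroup.mk_surjective q
      have hg : g ∈ MulAction.stabilizer G U := hstab ▸ Subgroup.mem_top g
      rw [MulAction.mem_stabilizer_iff] at hg
      rw [← hg]
      exact ⟨((1 : G) : G ⧸ ψ.range), ⟨x₀, congrArg _ ht⟩, by
        change ((g * 1 : G) : G ⧸ ψ.range) = _
        rw [mul_one]⟩
    have : Finite (G ⧸ ψ.range) := by
      rw [← Set.finite_univ_iff, ← htop]
      exact hU
    exact Subgroup.finiteIndex_of_finite_quotient

/-- The involution of `X × K` over the involution `τ` of `X`, with left translations by the labels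
`e` on fibres. -/
def labelledInvolution {X K : Type*} [Group K] (τ : X → X) (e : X → K) (hτ : ∀ x, τ (τ x) = x)
    (he : ∀ x, e (τ x) * e x = 1) : Equiv.Perm (X × K) :=
  Function.Involutive.toPerm (fun y => (τ y.1, e y.1 * y.2)) fun y => by
    simp [hτ, ← mul_assoc, he]

@[simp]
theorem labelledInvolution_apply {X K : Type*} [Group K] (τ : X → X) (e : X → K)
    (hτ : ∀ x, τ (τ x) = x) (he : ∀ x, e (τ x) * e x = 1) (x : X) (k : K) :
    labelledInvolution τ e hτ he (x, k) = (τ x, e x * k) := rfl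

theorem labelledInvolution_mul_self {X K : Type*} [Group K] (τ : X → X) (e : X → K)
    (hτ : ∀ x, τ (τ x) = x) (he : ∀ x, e (τ x) * e x = 1) :
    labelledInvolution τ e hτ he * labelledInvolution τ e hτ he = 1 := by
  ext1 ⟨x, k⟩
  simp [hτ, ← mul_assoc, he]

/-- The group generated by `sᵢ` subject to `(sᵢ sⱼ) ^ N i j = 1`. -/
def ReflectionGroup {ι : Type*} (N : ι → ι → ℕ) : Type _ :=
  PresentedGroup (Set.range (Function.uncurry fun i j =>
    (FreeGroup.of i * FreeGroup.of j) ^ N i j))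

namespace ReflectionGroup

variable {ι : Type*} {N : ι → ι → ℕ}

instance : Group (ReflectionGroup N) := inferInstanceAs (Group (PresentedGroup _))

/-- The standard generators of a reflection group. -/
def of (i : ι) : ReflectionGroup N := PresentedGroup.of i

theorem closure_range_of : Subgroup.closure (Set.range (of (N := N))) = ⊤ :=
  PresentedGroup.closure_range_of _

/-- The universal property of a reflection group. -/
def lift {H : Type*} [Group H] (f : ι → H) (hf : ∀ i j, (f i * f j) ^ N i j = 1) :
    ReflectionGroup N →* H :=
  PresentedGroup.toGroup (f := f) (by rintro _ ⟨⟨i, j⟩, rfl⟩; simpa using hf i j)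

@[simp]
theorem lift_of {H : Type*} [Group H] (f : ι → H) (hf : ∀ i j, (f i * f j) ^ N i j = 1) (i : ι) :
    lift f hf (of i) = f i := PresentedGroup.toGroup.of _

theorem of_mul_of_pow (i j : ι) : (of i * of j : ReflectionGroup N) ^ N i j = 1 :=
  PresentedGroup.one_of_mem ⟨(i, j), rfl⟩

theorem of_mul_self (hN : ∀ i, N i i = 1) (i : ι) : (of i * of i : ReflectionGroup N) = 1 := by
  simpa [hN] using of_mul_of_pow (N := N) i i

theorem inv_of (hN : ∀ i, N i i = 1) (i : ι) : (of i : ReflectionGroup N)⁻¹ = of i :=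
  inv_eq_of_mul_eq_one_left (of_mul_self hN i)

end ReflectionGroup

/-- The group presented like the subgroup of even elements of `ReflectionGroup N`; the generator
`of i` stands for the product `sₒ sᵢ`. -/
def EvenGroup {ι : Type*} (N : ι → ι → ℕ) (o : ι) : Type _ :=
  PresentedGroup (insert (FreeGroup.of o) (Set.range (Function.uncurry fun i j =>
    ((FreeGroup.of i)⁻¹ * FreeGroup.of j) ^ N i j)))

namespace EvenGroup

variable {ι : Type*} {N : ι → ι → ℕ} {o : ι}

instance : Group (EvenGroup N o) := inferInstanceAs (Group (PresentedGroup _))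

/-- The standard generators of the even group. -/
def of (i : ι) : EvenGroup N o := PresentedGroup.of i

theorem closure_range_of : Subgroup.closure (Set.range (of (N := N) (o := o))) = ⊤ :=
  PresentedGroup.closure_range_of _

/-- The universal property of the even group. -/
def lift {H : Type*} [Group H] (f : ι → H) (ho : f o = 1)
    (hf : ∀ i j, ((f i)⁻¹ * f j) ^ N i j = 1) : EvenGroup N o →* H :=
  PresentedGroup.toGroup (f := f) (by
    rintro _ (rfl | ⟨⟨i, j⟩, rfl⟩)
    · simpa using ho
    · simpa using hf i j)

@[simp]
theorem lift_of {H : Type*} [Group H] (f : ι → H) (ho : f o = 1)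
    (hf : ∀ i j, ((f i)⁻¹ * f j) ^ N i j = 1) (i : ι) :
    lift f ho hf (of i) = f i := PresentedGroup.toGroup.of _

theorem inv_of_mul_of_pow (i j : ι) : ((of i)⁻¹ * of j : EvenGroup N o) ^ N i j = 1 :=
  PresentedGroup.one_of_mem (Set.mem_insert_of_mem _ ⟨(i, j), rfl⟩)

theorem of_base : (of o : EvenGroup N o) = 1 :=
  PresentedGroup.one_of_mem (Set.mem_insert _ _)

end EvenGroup

open ReflectionGroup in
theorem ReflectionGroup.commensurable_evenGroup {ι : Type*} (N : ι → ι → ℕ) (o : ι)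
    (hN : ∀ i, N i i = 1) : AbstractlyCommensurable (ReflectionGroup N) (EvenGroup N o) := by
  let g : ι → EvenGroup N o := EvenGroup.of
  let ψ : EvenGroup N o →* ReflectionGroup N :=
    EvenGroup.lift (fun i => of o * of i) (of_mul_self hN o) (by
      intro i j
      rw [mul_inv_rev, mul_assoc, inv_mul_cancel_left, inv_of hN]
      exact of_mul_of_pow i j)
  let f : ι → Equiv.Perm (Bool × EvenGroup N o) := fun i =>
    labelledInvolution not (fun b => bif b then g i else (g i)⁻¹) Bool.not_not
      (by rintro (_ | _) <;> simp)
  have hpow : ∀ i j (n : ℕ), (f i * f j) ^ n =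
      ⟨fun y => (y.1, (bif y.1 then (g i)⁻¹ * g j else g i * (g j)⁻¹) ^ n * y.2),
        fun y => (y.1, ((bif y.1 then (g i)⁻¹ * g j else g i * (g j)⁻¹) ^ n)⁻¹ * y.2),
        fun y => by simp, fun y => by simp⟩ := by
    intro i j n
    induction n with
    | zero => ext1 ⟨b, k⟩; simp
    | succ n ih =>
      rw [pow_succ', ih]
      ext1 ⟨b, k⟩
      cases b <;> simp [f, pow_succ', mul_assoc]
  let ρ : ReflectionGroup N →* Equiv.Perm (Bool × EvenGroup N o) := lift f (by
    intro i j
    have h := EvenGroup.inv_of_mul_of_pow (N := N) (o := o) i j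
    have h' : (g i * (g j)⁻¹) ^ N i j = 1 := by
      have h2 : g i * (g j)⁻¹ = g j * ((g i)⁻¹ * g j)⁻¹ * (g j)⁻¹ := by group
      rw [h2, conj_pow, inv_pow]
      simp [g, h]
    rw [hpow]
    ext1 ⟨b, k⟩
    cases b
    · simp [h']
    · simp [g, h])
  refine .of_injective_left (injective_and_finiteIndex_range_of_action ψ ρ true
    (fun b => bif b then 1 else of o) EvenGroup.closure_range_of closure_range_of ?_ rfl ?_)
  · rintro _ ⟨i, rfl⟩ k
    simp [ψ, ρ, f, g, EvenGroup.of_base]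
  · have hmem : ∀ i, (of o * of i : ReflectionGroup N) ∈ ψ.range := fun i =>
      ⟨EvenGroup.of i, by simp [ψ]⟩
    rintro _ ⟨i, rfl⟩ b
    refine ⟨!b, ?_⟩
    cases b
    · simpa [inv_of hN] using inv_mem (hmem i)
    · simpa [inv_of hN] using hmem i

/-- The matrix of the reflection group of the right-angled `n`-gon. The sides are numbered
`0, …, n - 1`, and the superfluous generators `i ≥ n` are identified with the generator `0`. -/
def polygonMatrix (n i j : ℕ) : ℕ :=
  if i = j then 1 else if j = i + 1 then 2 else if j = 0 ∧ n ≤ i then 1 else 0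

theorem polygonMatrix_self (n i : ℕ) : polygonMatrix n i i = 1 := by simp [polygonMatrix]

/-- The reflection group of the right-angled `n`-gon. -/
abbrev PolygonGroup (n : ℕ) : Type := ReflectionGroup (polygonMatrix n)

namespace PolygonGroup

variable {n : ℕ}

/-- The reflections in the sides of the `n`-gon. -/
abbrev side (i : ℕ) : PolygonGroup n := ReflectionGroup.of i

@[simp]
theorem side_mul_self (i : ℕ) : (side i * side i : PolygonGroup n) = 1 :=
  ReflectionGroup.of_mul_self (polygonMatrix_self n) i

@[simp]
theorem side_inv (i : ℕ) : (side i : PolygonGroup n)⁻¹ = side i :=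
  ReflectionGroup.inv_of (polygonMatrix_self n) i

@[simp]
theorem side_mul_cancel_left (i : ℕ) (g : PolygonGroup n) : side i * (side i * g) = g := by
  rw [← mul_assoc, side_mul_self, one_mul]

theorem side_of_le {i : ℕ} (hi : n ≤ i) : (side i : PolygonGroup n) = side 0 := by
  rcases eq_or_ne i 0 with rfl | h
  · rfl
  have h1 := ReflectionGroup.of_mul_of_pow (N := polygonMatrix n) i 0
  rw [polygonMatrix, if_neg h, if_neg (by omega), if_pos ⟨rfl, hi⟩, pow_one] at h1
  rw [← side_inv 0]
  exact eq_inv_of_mul_eq_one_left h1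

theorem commute_side (i : ℕ) : Commute (side i : PolygonGroup n) (side (i + 1)) := by
  have h1 := ReflectionGroup.of_mul_of_pow (N := polygonMatrix n) i (i + 1)
  rw [polygonMatrix, if_neg (by omega), if_pos rfl, sq] at h1
  have h2 := eq_inv_of_mul_eq_one_left h1
  rwa [mul_inv_rev, side_inv, side_inv] at h2

theorem commute_side_zero {i : ℕ} (hi : n = i + 1) :
    Commute (side i : PolygonGroup n) (side 0) := by
  have h := commute_side (n := n) i
  rwa [side_of_le hi.le] at h

/-- The universal property of a polygon group. -/
def lift {H : Type*} [Group H] (f : ℕ → H) (hsq : ∀ i ≤ n, f i * f i = 1)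
    (hf : ∀ i < n, Commute (f i) (f (i + 1))) (hn : f n = f 0) : PolygonGroup n →* H :=
  ReflectionGroup.lift (fun i => f (min i n)) (by
    intro i j
    have hs : f (min i n) * f (min i n) = 1 := hsq _ (min_le_right _ _)
    unfold polygonMatrix
    split_ifs with h1 h2 h3
    · rw [← h1, pow_one, hs]
    · subst h2
      rcases lt_or_ge i n with h | h
      · rw [min_eq_left h.le, min_eq_left (Nat.succ_le_of_lt h)] at *
        rw [(hf i h).mul_pow, sq, sq, hs, one_mul, hsq _ h]
      · rw [min_eq_right h] at *
        rw [min_eq_right (by omega), hs, one_pow]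
    · rw [h3.1, min_eq_right h3.2] at *
      rw [min_eq_left (Nat.zero_le n), ← hn, pow_one]
      exact hsq n le_rfl
    · exact pow_zero _)

theorem lift_side {H : Type*} [Group H] (f : ℕ → H) (hsq : ∀ i ≤ n, f i * f i = 1)
    (hf : ∀ i < n, Commute (f i) (f (i + 1))) (hn : f n = f 0) {i : ℕ} (hi : i ≤ n) :
    lift f hsq hf hn (side i) = f i := by
  rw [lift, side, ReflectionGroup.lift_of, min_eq_left hi]

theorem closure_side : Subgroup.closure (side '' Set.Iio (n + 1)) =
    (⊤ : Subgroup (PolygonGroup n)) := by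
  rw [eq_top_iff, ← ReflectionGroup.closure_range_of, Subgroup.closure_le]
  rintro _ ⟨i, rfl⟩
  rcases lt_or_ge i (n + 1) with h | h
  · exact Subgroup.subset_closure ⟨i, h, rfl⟩
  · change side i ∈ _
    rw [side_of_le (by omega)]
    exact Subgroup.subset_closure ⟨0, Nat.succ_pos n, rfl⟩

end PolygonGroup

namespace PolygonGroup

/-- Generators of the pentagon group acting on a row of `n + 1` right-angled pentagons: the
neighbour of the pentagon `j` across the side `i`. -/
def rowNeighbour (n i j : ℕ) : ℕ :=
  if i = 1 ∨ i = 3 ∨ i = 4 then j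
  else if (i = 2 ↔ j % 2 = 0) then min (j + 1) n else j - 1

/-- The side of the big polygon formed by a row of `n + 1` pentagons which contains the side `i` of
the pentagon `j`, if there is one. -/
def rowLabel (n i j : ℕ) : PolygonGroup (n + 5) :=
  if i = 1 then side (n + 4)
  else if i = 3 then (if j % 2 = 0 then side (j + 2) else side (j + 1))
  else if i = 4 then (if j % 2 = 0 then side (j + 1) else side (j + 2))
  else if (i = 2 ↔ j % 2 = 0) then (if j < n then 1 else side (n + 3))
  else if j = 0 then side 0 else 1

theorem rowNeighbour_lt {n i j : ℕ} (hj : j < n + 1) : rowNeighbour n i j < n + 1 := by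
  unfold rowNeighbour
  split_ifs <;> omega

theorem rowNeighbour_rowNeighbour {n i j : ℕ} (hj : j < n + 1) :
    rowNeighbour n i (rowNeighbour n i j) = j := by
  unfold rowNeighbour
  grind

theorem rowLabel_mul_rowLabel {n i j : ℕ} (hj : j < n + 1) :
    rowLabel n i (rowNeighbour n i j) * rowLabel n i j = 1 := by
  unfold rowNeighbour rowLabel
  by_cases h1 : i = 1
  · simp [h1]
  by_cases h3 : i = 3
  · simp [h3]; split_ifs <;> simp
  by_cases h4 : i = 4
  · simp [h4]; split_ifs <;> simp
  simp only [h1, h3, h4, or_self, if_false]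
  grind [side_mul_self]

/-- The action of the `i`-th reflection of the pentagon group on a row of pentagons, with values in
the group of the polygon formed by the row. -/
def rowPerm (n i : ℕ) : Equiv.Perm (Fin (n + 1) × PolygonGroup (n + 5)) :=
  labelledInvolution (fun j => ⟨rowNeighbour n i j, rowNeighbour_lt j.2⟩)
    (fun j => rowLabel n i j) (fun j => Fin.ext (rowNeighbour_rowNeighbour j.2))
    (fun j => rowLabel_mul_rowLabel j.2)

theorem rowNeighbour_comm {n i i' j : ℕ} (hi : i' = i + 1 ∨ i = 4 ∧ i' = 0) :
    rowNeighbour n i (rowNeighbour n i' j) = rowNeighbour n i' (rowNeighbour n i j) := by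
  unfold rowNeighbour
  grind

theorem rowLabel_comm {n i i' j : ℕ} (hi : i' = i + 1 ∧ i < 4 ∨ i = 4 ∧ i' = 0)
    (hj : j < n + 1) :
    rowLabel n i (rowNeighbour n i' j) * rowLabel n i' j =
      rowLabel n i' (rowNeighbour n i j) * rowLabel n i j := by
  have h1 : (side (n + 4) * side 0 : PolygonGroup (n + 5)) = side 0 * side (n + 4) :=
    commute_side_zero rfl
  have h2 : ∀ i, (side i * side (i + 1) : PolygonGroup (n + 5)) = side (i + 1) * side i :=
    commute_side
  have h3 := h2 0
  have h4 := h2 (n + 3)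
  have h5 := h2 (n + 2)
  have h6 := h2 (n + 1)
  have h7 := h2 (j + 1)
  rcases hi with ⟨rfl, hi⟩ | ⟨rfl, rfl⟩
  · interval_cases i <;> simp [rowNeighbour, rowLabel] <;> grind
  · simp [rowNeighbour, rowLabel]
    grind

theorem rowPerm_commute {n i i' : ℕ} (hi : i' = i + 1 ∧ i < 4 ∨ i = 4 ∧ i' = 0) :
    Commute (rowPerm n i) (rowPerm n i') := by
  ext1 ⟨j, k⟩
  simp only [rowPerm, Equiv.Perm.mul_apply, labelledInvolution_apply, ← mul_assoc]
  rw [rowLabel_comm hi j.2]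
  simp only [rowNeighbour_comm (show i' = i + 1 ∨ i = 4 ∧ i' = 0 by omega)]

end PolygonGroup

theorem perm_conj_apply {G X K : Type*} [Group G] [Group K] (ρ : G →* Equiv.Perm (X × K))
    {x₀ x x' : X} {t t' g : G} {e : K} (ht : ∀ k, ρ t (x₀, k) = (x, k))
    (ht' : ∀ k, ρ t' (x₀, k) = (x', k)) (hg : ∀ k, ρ g (x, k) = (x', e * k)) (k : K) :
    ρ (t'⁻¹ * (g * t)) (x₀, k) = (x₀, e * k) := by
  rw [map_mul, map_mul, map_inv, Equiv.Perm.mul_apply, Equiv.Perm.mul_apply, ht, hg,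
    Equiv.Perm.inv_eq_iff_eq, ht']

namespace PolygonGroup

/-- The side of the pentagon `j` of a row shared with the pentagon `j + 1`. -/
def rowExit (j : ℕ) : PolygonGroup 5 := if j % 2 = 0 then side 2 else side 0

/-- The outer side of the pentagon `j` of a row which is shared with the pentagon `j - 1`. -/
def rowFirst (j : ℕ) : PolygonGroup 5 := if j % 2 = 0 then side 4 else side 3

/-- The product of reflections mapping the pentagon `0` of a row to the pentagon `j`. -/
def rowPath : ℕ → PolygonGroup 5
  | 0 => 1
  | j + 1 => rowExit j * rowPath j

theorem rowExit_mul_self (j : ℕ) : rowExit j * rowExit j = 1 := by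
  unfold rowExit; split_ifs <;> simp

theorem rowFirst_mul_self (j : ℕ) : rowFirst j * rowFirst j = 1 := by
  unfold rowFirst; split_ifs <;> simp

theorem rowFirst_commute (j : ℕ) : Commute (rowFirst j) (rowFirst (j + 1)) := by
  have h : Commute (side 3 : PolygonGroup 5) (side 4) := commute_side 3
  rcases Nat.mod_two_eq_zero_or_one j with hj | hj
  · simpa [rowFirst, hj, Nat.add_mod] using h.symm
  · simpa [rowFirst, hj, Nat.add_mod] using h

theorem rowFirst_succ_commute (j : ℕ) : Commute (rowFirst (j + 1)) (rowExit j) := by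
  have h : Commute (side 2 : PolygonGroup 5) (side 3) := commute_side 2
  have h' : Commute (side 4 : PolygonGroup 5) (side 0) := commute_side_zero rfl
  rcases Nat.mod_two_eq_zero_or_one j with hj | hj
  · simpa [rowFirst, rowExit, hj, Nat.add_mod] using h.symm
  · simpa [rowFirst, rowExit, hj, Nat.add_mod] using h'

theorem side_one_commute_rowPath (j : ℕ) : Commute (side 1) (rowPath j) := by
  induction j with
  | zero => exact Commute.one_right _
  | succ j ih =>
    refine Commute.mul_right ?_ ih
    unfold rowExit
    split_ifs
    · exact commute_side 1
    · exact (commute_side 0).symm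

theorem rowFirst_succ_conj (j : ℕ) :
    (rowPath (j + 1))⁻¹ * (rowFirst (j + 1) * rowPath (j + 1)) =
      (rowPath j)⁻¹ * (rowFirst (j + 1) * rowPath j) := by
  rw [rowPath, ← mul_assoc (rowFirst _), (rowFirst_succ_commute j).eq]
  simp [mul_assoc]

theorem conj_mul_self_eq_one {G : Type*} [Group G] {a : G} (t : G) (h : a * a = 1) :
    t⁻¹ * (a * t) * (t⁻¹ * (a * t)) = 1 := by
  simp [mul_assoc, ← mul_assoc a a, h]

theorem conj_commute {G : Type*} [Group G] {a b : G} (t : G) (h : Commute a b) :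
    Commute (t⁻¹ * (a * t)) (t⁻¹ * (b * t)) := by
  simpa [mul_assoc] using (Commute.conj_iff t⁻¹).2 h

/-- The reflections in the sides of the polygon formed by a row of `n + 1` pentagons. -/
def rowReflection (n i : ℕ) : PolygonGroup 5 :=
  if i = 0 then side 0
  else if i ≤ n + 2 then (rowPath (i - 1))⁻¹ * (rowFirst (i - 1) * rowPath (i - 1))
  else if i = n + 3 then (rowPath n)⁻¹ * (rowExit n * rowPath n)
  else if i = n + 4 then side 1
  else side 0

theorem rowReflection_mul_self (n i : ℕ) : rowReflection n i * rowReflection n i = 1 := by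
  unfold rowReflection
  split_ifs
  any_goals simp only [side_mul_self]
  · exact conj_mul_self_eq_one _ (rowFirst_mul_self _)
  · exact conj_mul_self_eq_one _ (rowExit_mul_self _)

theorem rowReflection_succ {n j : ℕ} (hj : j ≤ n + 1) :
    rowReflection n (j + 1) = (rowPath j)⁻¹ * (rowFirst j * rowPath j) := by
  rw [rowReflection, if_neg (by omega), if_pos (by omega), Nat.add_sub_cancel]

theorem rowReflection_add_two {n j : ℕ} (hj : j ≤ n) :
    rowReflection n (j + 2) = (rowPath j)⁻¹ * (rowFirst (j + 1) * rowPath j) := by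
  rw [rowReflection_succ (by omega), rowFirst_succ_conj]

theorem rowReflection_add_three (n : ℕ) :
    rowReflection n (n + 3) = (rowPath n)⁻¹ * (rowExit n * rowPath n) := by
  simp [rowReflection]

theorem rowReflection_add_four (n : ℕ) : rowReflection n (n + 4) = side 1 := by
  simp [rowReflection]

theorem side_one_conj (j : ℕ) : (rowPath j)⁻¹ * (side 1 * rowPath j) = side 1 := by
  rw [(side_one_commute_rowPath j).eq, inv_mul_cancel_left]

theorem rowReflection_commute {n i : ℕ} (hi : i < n + 5) :
    Commute (rowReflection n i) (rowReflection n (i + 1)) := by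
  obtain rfl | ⟨j, hj, rfl⟩ | rfl | rfl | rfl : i = 0 ∨ (∃ j ≤ n, i = j + 1) ∨ i = n + 2 ∨
      i = n + 3 ∨ i = n + 4 := by
    rcases i with _ | i
    · exact Or.inl rfl
    · by_cases h : i ≤ n
      · exact Or.inr (Or.inl ⟨i, h, rfl⟩)
      · omega
  · rw [rowReflection_succ (by omega)]
    simpa [rowReflection, rowPath, rowFirst] using
      (commute_side_zero (n := 5) (i := 4) rfl).symm
  · rw [rowReflection_succ (by omega), rowReflection_add_two hj]
    exact conj_commute _ (rowFirst_commute j)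
  · rw [rowReflection_add_two le_rfl, rowReflection_add_three]
    exact conj_commute _ (rowFirst_succ_commute n)
  · rw [rowReflection_add_three, rowReflection_add_four, ← side_one_conj n]
    refine conj_commute _ ?_
    unfold rowExit
    split_ifs
    · exact (commute_side 1).symm
    · exact commute_side 0
  · rw [rowReflection_add_four]
    simpa [rowReflection] using (commute_side (n := 5) 0).symm

theorem commensurable_pentagon (n : ℕ) :
    AbstractlyCommensurable (PolygonGroup 5) (PolygonGroup (n + 5)) := by
  let ψ : PolygonGroup (n + 5) →* PolygonGroup 5 :=
    lift (rowReflection n) (fun i _ => rowReflection_mul_self n i)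
      (fun i hi => rowReflection_commute hi) (by simp [rowReflection])
  have hψ : ∀ i ≤ n + 5, ψ (side i) = rowReflection n i := fun i hi => lift_side _ _ _ _ hi
  let f : ℕ → Equiv.Perm (Fin (n + 1) × PolygonGroup (n + 5)) :=
    fun i => rowPerm n (if i = 5 then 0 else i)
  let ρ : PolygonGroup 5 →* Equiv.Perm (Fin (n + 1) × PolygonGroup (n + 5)) :=
    lift f (fun i _ => labelledInvolution_mul_self _ _ _ _) (by
      intro i hi
      refine rowPerm_commute ?_
      split_ifs <;> omega) (by simp [f])
  have hρ : ∀ i < 5, ρ (side i) = rowPerm n i := by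
    intro i hi
    rw [show ρ (side i) = f i from lift_side _ _ _ _ hi.le]
    simp [f, hi.ne]
  have hpath : ∀ j (hj : j < n + 1), ∀ k, ρ (rowPath j) (0, k) = (⟨j, hj⟩, k) := by
    intro j
    induction j with
    | zero => intro hj k; simp [rowPath]
    | succ j ih =>
      intro hj k
      rw [rowPath, map_mul, Equiv.Perm.mul_apply, ih (by omega)]
      rcases Nat.mod_two_eq_zero_or_one j with h | h
      · rw [rowExit, if_pos h, hρ 2 (by norm_num)]
        simp [rowPerm, rowNeighbour, rowLabel, h]
        omega
      · rw [rowExit, if_neg (by omega), hρ 0 (by norm_num)]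
        simp [rowPerm, rowNeighbour, rowLabel, h]
        omega
  have hconj : ∀ j (hj : j < n + 1) (g : PolygonGroup 5) e,
      (∀ k, ρ g (⟨j, hj⟩, k) = (⟨j, hj⟩, e * k)) → ∀ k,
      ρ ((rowPath j)⁻¹ * (g * rowPath j)) (0, k) = (0, e * k) := fun j hj g e =>
    perm_conj_apply ρ (hpath j hj) (hpath j hj)
  have hmem : ∀ i ≤ n + 5, rowReflection n i ∈ ψ.range := fun i hi => ⟨side i, hψ i hi⟩
  refine .of_injective_left (injective_and_finiteIndex_range_of_action ψ ρ 0
    (fun j => rowPath j) closure_side closure_side ?_ rfl ?_)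
  · rintro _ ⟨i, hi, rfl⟩ k
    have hi' : i < n + 6 := hi
    rw [hψ i (by omega)]
    obtain rfl | ⟨j, hj, rfl⟩ | rfl | rfl | rfl | rfl : i = 0 ∨ (∃ j ≤ n, i = j + 1) ∨ i = n + 2 ∨
        i = n + 3 ∨ i = n + 4 ∨ i = n + 5 := by
      rcases i with _ | i
      · exact Or.inl rfl
      · by_cases h : i ≤ n
        · exact Or.inr (Or.inl ⟨i, h, rfl⟩)
        · omega
    · simp only [rowReflection, if_true, hρ 0 (by norm_num)]
      simp [rowPerm, rowNeighbour, rowLabel]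
    · rw [rowReflection_succ (by omega)]
      refine hconj j (by omega) _ _ (fun k => ?_) k
      rcases Nat.mod_two_eq_zero_or_one j with h | h
      · rw [rowFirst, if_pos h, hρ 4 (by norm_num)]
        simp [rowPerm, rowNeighbour, rowLabel, h]
      · rw [rowFirst, if_neg (by omega), hρ 3 (by norm_num)]
        simp [rowPerm, rowNeighbour, rowLabel, h]
    · rw [rowReflection_add_two le_rfl]
      refine hconj n (by omega) _ _ (fun k => ?_) k
      rcases Nat.mod_two_eq_zero_or_one n with h | h
      · rw [rowFirst, if_neg (by omega), hρ 3 (by norm_num)]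
        simp [rowPerm, rowNeighbour, rowLabel, h]
      · rw [rowFirst, if_pos (by omega), hρ 4 (by norm_num)]
        simp [rowPerm, rowNeighbour, rowLabel, h]
    · rw [rowReflection_add_three]
      refine hconj n (by omega) _ _ (fun k => ?_) k
      rcases Nat.mod_two_eq_zero_or_one n with h | h
      · rw [rowExit, if_pos h, hρ 2 (by norm_num)]
        simp [rowPerm, rowNeighbour, rowLabel, h]
      · rw [rowExit, if_neg (by omega), hρ 0 (by norm_num)]
        simp [rowPerm, rowNeighbour, rowLabel, h]
    · rw [rowReflection_add_four, hρ 1 (by norm_num)]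
      simp [rowPerm, rowNeighbour, rowLabel]
    · rw [side_of_le le_rfl, show rowReflection n (n + 5) = side 0 by simp [rowReflection],
        hρ 0 (by norm_num)]
      simp [rowPerm, rowNeighbour, rowLabel]
  · rintro _ ⟨i, hi, rfl⟩ ⟨j, hj⟩
    have hi' : i < 6 := hi
    have hfirst : (rowPath j)⁻¹ * (rowFirst j * rowPath j) ∈ ψ.range := by
      rw [← rowReflection_succ (n := n) (by omega)]
      exact hmem _ (by omega)
    have hsecond : (rowPath j)⁻¹ * (rowFirst (j + 1) * rowPath j) ∈ ψ.range := by
      rw [← rowReflection_add_two (n := n) (by omega)]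
      exact hmem _ (by omega)
    have hexit : ∃ x : Fin (n + 1), (rowPath x)⁻¹ * (rowExit j * rowPath j) ∈ ψ.range := by
      rcases Nat.lt_succ_iff_lt_or_eq.1 hj with h | h
      · refine ⟨⟨j + 1, by omega⟩, ?_⟩
        rw [← rowPath, inv_mul_cancel]
        exact one_mem _
      · subst h
        refine ⟨⟨j, hj⟩, ?_⟩
        rw [← rowReflection_add_three]
        exact hmem _ (by omega)
    have henter : ∃ x : Fin (n + 1), (rowPath x)⁻¹ * (rowExit (j + 1) * rowPath j) ∈ ψ.range := by
      rcases j with _ | j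
      · refine ⟨0, ?_⟩
        have h : rowReflection n 0 ∈ ψ.range := hmem _ (by omega)
        simpa [rowReflection, rowPath, rowExit] using h
      · refine ⟨⟨j, by omega⟩, ?_⟩
        rw [show rowExit (j + 1 + 1) = rowExit j by simp [rowExit, add_assoc], rowPath,
          ← mul_assoc (rowExit j), rowExit_mul_self, one_mul, inv_mul_cancel]
        exact one_mem _
    have hone : (rowPath j)⁻¹ * (side 1 * rowPath j) ∈ ψ.range := by
      rw [side_one_conj, ← rowReflection_add_four n]
      exact hmem _ (by omega)
    have hzero : ∃ x : Fin (n + 1), (rowPath x)⁻¹ * (side 0 * rowPath j) ∈ ψ.range := by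
      rcases Nat.mod_two_eq_zero_or_one j with h | h
      · simpa [rowExit, Nat.add_mod, h] using henter
      · simpa [rowExit, h] using hexit
    interval_cases i
    · exact hzero
    · exact ⟨⟨j, hj⟩, hone⟩
    · rcases Nat.mod_two_eq_zero_or_one j with h | h
      · simpa [rowExit, h] using hexit
      · simpa [rowExit, Nat.add_mod, h] using henter
    · refine ⟨⟨j, hj⟩, ?_⟩
      rcases Nat.mod_two_eq_zero_or_one j with h | h
      · simpa [rowFirst, Nat.add_mod, h] using hsecond
      · simpa [rowFirst, h] using hfirst
    · refine ⟨⟨j, hj⟩, ?_⟩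
      rcases Nat.mod_two_eq_zero_or_one j with h | h
      · simpa [rowFirst, h] using hfirst
      · simpa [rowFirst, Nat.add_mod, h] using hsecond
    · rw [side_of_le le_rfl]
      exact hzero

end PolygonGroup

/-- The action of a group on the first factor of a product with itself. -/
def fibrewiseMulLeft (D K : Type*) [Group D] : D →* Equiv.Perm (D × K) where
  toFun d := (Equiv.mulLeft d).prodCongr (Equiv.refl K)
  map_one' := by ext1 ⟨x, k⟩; simp
  map_mul' a b := by ext1 ⟨x, k⟩; simp [mul_assoc]

@[simp]
theorem fibrewiseMulLeft_apply {D K : Type*} [Group D] (d x : D) (k : K) :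
    fibrewiseMulLeft D K d (x, k) = (d * x, k) := rfl

theorem pow_zmod_val_add_one {G : Type*} [Group G] {m : ℕ} [NeZero m] {w : G} (hw : w ^ m = 1)
    (i : ZMod m) : w ^ (i + 1).val = w * w ^ i.val := by
  rw [← pow_succ', pow_eq_pow_mod _ hw, eq_comm, pow_eq_pow_mod _ hw]
  congr 1
  rw [← ZMod.val_natCast, ← ZMod.val_natCast]
  simp

theorem PolygonGroup.commute_side_zmod_val {m : ℕ} [NeZero m] (i : ZMod m) :
    Commute (side i.val : PolygonGroup m) (side (i + 1).val) := by
  have h := commute_side (n := m) i.val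
  have h1 : (i + 1).val = (i.val + 1) % m := by
    rw [← ZMod.val_natCast]
    simp
  rcases (Nat.succ_le_of_lt (ZMod.val_lt i)).lt_or_eq with h2 | h2
  · rwa [h1, Nat.mod_eq_of_lt h2]
  · rw [h1, show i.val + 1 = m from h2, Nat.mod_self]
    exact commute_side_zero h2.symm

theorem sq_eq_one_of_comm {G : Type*} [Group G] {a b : G} (ha : a * a = 1) (hb : b * b = 1)
    (h : Commute a b) : (a * b) ^ 2 = 1 := by
  rw [h.mul_pow, sq, sq, ha, hb, one_mul]

open DihedralGroup in
theorem PolygonGroup.commensurable_triangleGroup {m : ℕ} [NeZero m] (N : Fin 3 → Fin 3 → ℕ)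
    (hN : ∀ i, N i i = 1) (hsymm : ∀ i j, N i j = N j i) (h01 : N 0 1 = m) (h12 : N 1 2 = 4)
    (h02 : N 0 2 = 2) : AbstractlyCommensurable (ReflectionGroup N) (PolygonGroup m) := by
  have hcomm : ∀ i : ZMod m, (side i.val * side (i + 1).val : PolygonGroup m) =
      side (i + 1).val * side i.val := commute_side_zmod_val
  let c : Equiv.Perm (DihedralGroup m × PolygonGroup m) :=
    labelledInvolution id (fun x => match x with | r i | sr i => side i.val)
      (fun _ => rfl) (fun x => by cases x <;> simp)
  have hc : c * c = 1 := labelledInvolution_mul_self _ _ _ _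
  let f : Fin 3 → Equiv.Perm (DihedralGroup m × PolygonGroup m) :=
    ![fibrewiseMulLeft _ _ (sr 0), fibrewiseMulLeft _ _ (sr 1), c]
  have hsq : ∀ i, f i * f i = 1 := by
    intro i
    fin_cases i
    · exact (map_mul (fibrewiseMulLeft _ _) _ _).symm.trans (by simp)
    · exact (map_mul (fibrewiseMulLeft _ _) _ _).symm.trans (by simp)
    · exact hc
  have hswap : ∀ i j k, (f i * f j) ^ k = 1 → (f j * f i) ^ k = 1 := by
    intro i j k h
    rw [← inv_inj, ← inv_pow, mul_inv_rev, inv_eq_of_mul_eq_one_left (hsq i),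
      inv_eq_of_mul_eq_one_left (hsq j), h, inv_one]
  have hf01 : (f 0 * f 1) ^ m = 1 := by
    simp [f, ← map_mul, ← map_pow]
  have hf02 : (f 0 * f 2) ^ 2 = 1 := by
    refine sq_eq_one_of_comm (hsq 0) (hsq 2) ?_
    ext1 ⟨x, k⟩
    cases x <;> simp [f, c]
  have hf12 : (f 1 * f 2) ^ 4 = 1 := by
    rw [show 4 = 2 + 2 from rfl, pow_add]
    ext1 ⟨x, k⟩
    cases x with
    | r i =>
      have h : (side (i + 1).val * (side i.val * (side (i + 1).val * (side i.val * k))) :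
          PolygonGroup m) = k := by
        rw [← mul_assoc (side i.val), hcomm, mul_assoc, side_mul_cancel_left,
          side_mul_cancel_left]
      simpa [f, c, sq, add_comm] using h
    | sr i =>
      have h : (side (i - 1).val * (side i.val * (side (i - 1).val * (side i.val * k))) :
          PolygonGroup m) = k := by
        have h1 := hcomm (i - 1)
        rw [sub_add_cancel] at h1
        rw [← mul_assoc (side i.val), ← h1, mul_assoc, side_mul_cancel_left,
          side_mul_cancel_left]
      simpa [f, c, sq] using h
  let ρ : ReflectionGroup N →* Equiv.Perm (DihedralGroup m × PolygonGroup m) :=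
    ReflectionGroup.lift f (by
      intro i j
      fin_cases i <;> fin_cases j <;> dsimp only [Fin.zero_eta, Fin.mk_one, Fin.reduceFinMk]
      · simp [hN, hsq]
      · rw [h01, hf01]
      · rw [h02, hf02]
      · rw [hsymm, h01, hswap _ _ _ hf01]
      · simp [hN, hsq]
      · rw [h12, hf12]
      · rw [hsymm, h02, hswap _ _ _ hf02]
      · rw [hsymm, h12, hswap _ _ _ hf12]
      · simp [hN, hsq])
  let s : Fin 3 → ReflectionGroup N := ReflectionGroup.of
  have hs : ∀ i, s i * s i = 1 := ReflectionGroup.of_mul_self hN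
  have hsinv : ∀ i, (s i)⁻¹ = s i := ReflectionGroup.inv_of hN
  let w := s 0 * s 1
  have hw : w ^ m = 1 := h01 ▸ ReflectionGroup.of_mul_of_pow 0 1
  have h02' : Commute (s 0) (s 2) := by
    have h := ReflectionGroup.of_mul_of_pow (N := N) 0 2
    rw [h02, sq] at h
    have h2 := eq_inv_of_mul_eq_one_left h
    rwa [mul_inv_rev, ReflectionGroup.inv_of hN, ReflectionGroup.inv_of hN] at h2
  have h12' : Commute (s 2) (w⁻¹ * (s 2 * w)) := by
    have h : w⁻¹ * (s 2 * w) = s 1 * (s 2 * s 1) := by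
      simp only [w, mul_inv_rev, hsinv, mul_assoc]
      rw [← mul_assoc (s 2), ← h02'.eq, mul_assoc, ← mul_assoc (s 0) (s 0), hs, one_mul]
    have h1 := ReflectionGroup.of_mul_of_pow (N := N) 1 2
    rw [h12, show 4 = 2 + 2 from rfl, pow_add] at h1
    have h2 := eq_inv_of_mul_eq_one_left h1
    rw [sq, mul_inv_rev, mul_inv_rev, ReflectionGroup.inv_of hN, ReflectionGroup.inv_of hN] at h2
    rw [h, Commute, SemiconjBy]
    simpa [mul_assoc] using h2.symm
  let γ : ℕ → ReflectionGroup N := fun j => (w ^ j)⁻¹ * (s 2 * w ^ j)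
  let ψ : PolygonGroup m →* ReflectionGroup N :=
    lift γ (fun i _ => conj_mul_self_eq_one _ (hs 2)) (fun i _ => by
      have h : γ (i + 1) = (w ^ i)⁻¹ * (w⁻¹ * (s 2 * w) * w ^ i) := by
        simp only [γ, pow_succ', mul_inv_rev, mul_assoc]
      rw [h]
      exact conj_commute _ h12') (by simp [γ, hw])
  have hψ : ∀ i ≤ m, ψ (side i) = γ i := fun i hi => lift_side _ _ _ _ hi
  have hρ : ∀ i, ρ (s i) = f i := fun i => ReflectionGroup.lift_of _ _ _
  have hρw : ∀ i : ℕ, ρ (w ^ i) = fibrewiseMulLeft _ _ (r (i : ZMod m)) := by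
    intro i
    rw [map_pow, map_mul, hρ, hρ]
    simp [f, ← map_mul, ← map_pow]
  refine .of_injective_left (injective_and_finiteIndex_range_of_action ψ ρ 1
    (fun x => match x with | r i => w ^ i.val | sr i => s 0 * w ^ i.val) closure_side
    ReflectionGroup.closure_range_of ?_ ?_ ?_)
  · rintro _ ⟨i, hi, rfl⟩ k
    have hi' : i ≤ m := Nat.le_of_lt_succ hi
    rw [hψ i hi']
    refine perm_conj_apply ρ (x := r i) (x' := r i) (fun k => ?_) (fun k => ?_) (fun k => ?_) k
    · rw [hρw, fibrewiseMulLeft_apply, mul_one]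
    · rw [hρw, fibrewiseMulLeft_apply, mul_one]
    · rw [hρ]
      change (r (i : ZMod m), side (i : ZMod m).val * k) = _
      rcases hi'.lt_or_eq with h | rfl
      · rw [ZMod.val_cast_of_lt h]
      · rw [ZMod.natCast_self, ZMod.val_zero, side_of_le le_rfl]
  · change w ^ (0 : ZMod m).val = 1
    simp
  · have hmem : ∀ i : ZMod m, γ i.val ∈ ψ.range := fun i => ⟨side i.val, hψ _ (ZMod.val_lt i).le⟩
    rintro _ ⟨i, rfl⟩ x
    have hw1 := pow_zmod_val_add_one hw
    rcases x with j | j <;> fin_cases i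
    · refine ⟨sr j, ?_⟩
      change (s 0 * w ^ j.val)⁻¹ * (s 0 * w ^ j.val) ∈ _
      simp
    · refine ⟨sr (j + 1), ?_⟩
      change (s 0 * w ^ (j + 1).val)⁻¹ * (s 1 * w ^ j.val) ∈ _
      have h : s 0 * (w * w ^ j.val) = s 1 * w ^ j.val := by
        rw [← mul_assoc, ← mul_assoc, hs, one_mul]
      rw [hw1, h, inv_mul_cancel]
      exact one_mem _
    · exact ⟨r j, hmem j⟩
    · refine ⟨r j, ?_⟩
      change (w ^ j.val)⁻¹ * (s 0 * (s 0 * w ^ j.val)) ∈ _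
      simp [← mul_assoc (s 0), hs]
    · refine ⟨r (j - 1), ?_⟩
      change (w ^ (j - 1).val)⁻¹ * (s 1 * (s 0 * w ^ j.val)) ∈ _
      have h := hw1 (j - 1)
      rw [sub_add_cancel] at h
      have h' : s 1 * (s 0 * (w * w ^ (j - 1).val)) = w ^ (j - 1).val := by
        simp only [w, mul_assoc]
        rw [← mul_assoc (s 0) (s 0), hs, one_mul, ← mul_assoc, hs, one_mul]
      rw [h, h', inv_mul_cancel]
      exact one_mem _
    · refine ⟨sr j, ?_⟩
      change (s 0 * w ^ j.val)⁻¹ * (s 2 * (s 0 * w ^ j.val)) ∈ _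
      rw [← mul_assoc (s 2), ← h02'.eq, mul_inv_rev]
      simpa [mul_assoc] using hmem j

/-- The even subgroup of the reflection group of the right-angled `n`-gon. -/
abbrev EvenPolygonGroup (n : ℕ) : Type := EvenGroup (polygonMatrix n) 0

/-- The relations between the products `s₀ sᵢ` of reflections in the sides of a right-angled
`n`-gon. -/
structure IsEvenPolygonFamily {H : Type*} [Group H] (n : ℕ) (γ : ℕ → H) : Prop where
  zero : γ 0 = 1
  last : γ n = 1
  sq : ∀ i < n, ((γ i)⁻¹ * γ (i + 1)) * ((γ i)⁻¹ * γ (i + 1)) = 1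

namespace EvenPolygonGroup

variable {n : ℕ}

theorem isEvenPolygonFamily :
    IsEvenPolygonFamily n (EvenGroup.of : ℕ → EvenPolygonGroup n) where
  zero := EvenGroup.of_base
  last := by
    rcases eq_or_ne n 0 with h | h
    · rw [h]
      exact EvenGroup.of_base
    · have h1 := EvenGroup.inv_of_mul_of_pow (N := polygonMatrix n) (o := 0) n 0
      rw [polygonMatrix, if_neg h, if_neg (by omega), if_pos ⟨rfl, le_rfl⟩, pow_one,
        EvenGroup.of_base, mul_one] at h1
      exact inv_eq_one.1 h1
  sq i _ := by
    have h1 := EvenGroup.inv_of_mul_of_pow (N := polygonMatrix n) (o := 0) i (i + 1)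
    rwa [polygonMatrix, if_neg (by omega), if_pos rfl, sq] at h1

theorem of_of_le {i : ℕ} (hi : n ≤ i) : (EvenGroup.of i : EvenPolygonGroup n) = 1 := by
  rcases eq_or_ne i 0 with rfl | h
  · exact EvenGroup.of_base
  have h1 := EvenGroup.inv_of_mul_of_pow (N := polygonMatrix n) (o := 0) i 0
  rw [polygonMatrix, if_neg h, if_neg (by omega), if_pos ⟨rfl, hi⟩, pow_one,
    EvenGroup.of_base, mul_one] at h1
  exact inv_eq_one.1 h1

theorem exists_hom {H : Type*} [Group H] {γ : ℕ → H} (hγ : IsEvenPolygonFamily n γ) :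
    ∃ ψ : EvenPolygonGroup n →* H, ∀ i ≤ n, ψ (EvenGroup.of i) = γ i := by
  refine ⟨EvenGroup.lift (fun i => γ (min i n)) (by simpa using hγ.zero) ?_, fun i hi => ?_⟩
  · intro i j
    unfold polygonMatrix
    split_ifs with h1 h2 h3
    · rw [h1, pow_one, inv_mul_cancel]
    · subst h2
      rcases lt_or_ge i n with h | h
      · rw [min_eq_left h.le, min_eq_left (Nat.succ_le_of_lt h), sq, hγ.sq i h]
      · rw [min_eq_right h, min_eq_right (by omega), inv_mul_cancel, one_pow]
    · rw [h3.1, min_eq_right h3.2, min_eq_left (Nat.zero_le n), hγ.zero, hγ.last, pow_one,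
        inv_mul_cancel]
    · exact pow_zero _
  · rw [EvenGroup.lift_of, min_eq_left hi]

theorem closure_of : Subgroup.closure (EvenGroup.of '' Set.Iio n) =
    (⊤ : Subgroup (EvenPolygonGroup n)) := by
  rw [eq_top_iff, ← EvenGroup.closure_range_of, Subgroup.closure_le]
  rintro _ ⟨i, rfl⟩
  rcases lt_or_ge i n with h | h
  · exact Subgroup.subset_closure ⟨i, h, rfl⟩
  · rw [SetLike.mem_coe, of_of_le h]
    exact one_mem _

end EvenPolygonGroup

/-- The next side of the same `m`-gon, where `(a, i)` stands for the side `i` of the face `a`. -/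
def nextSide (m : ℕ) (d : ℕ × ℕ) : ℕ × ℕ := (d.1, (d.2 + 1) % m)

theorem iterate_nextSide (m k : ℕ) {d : ℕ × ℕ} (hd : d.2 < m) :
    (nextSide m)^[k] d = (d.1, (d.2 + k) % m) := by
  induction k with
  | zero => simp [Nat.mod_eq_of_lt hd]
  | succ k ih => rw [Function.iterate_succ_apply', ih, nextSide, Nat.mod_add_mod, add_assoc]

/-- The sides `d`, `d'`, `d''` are consecutive at a vertex of degree three of the map obtained by
gluing polygons along `τ`. -/
structure IsVertex (m : ℕ) (τ : ℕ × ℕ → ℕ × ℕ) (d d' d'' : ℕ × ℕ) : Prop where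
  fst : nextSide m (τ d) = d'
  snd : nextSide m (τ d') = d''
  trd : nextSide m (τ d'') = d

theorem IsVertex.rotate {m : ℕ} {τ : ℕ × ℕ → ℕ × ℕ} {d d' d'' : ℕ × ℕ}
    (h : IsVertex m τ d d' d'') : IsVertex m τ d' d'' d := ⟨h.snd, h.trd, h.fst⟩

/-- A gluing of three `m`-gons (allowing sides to be folded) to a surface all of whose vertices have
degree three; the faces `0` and `1` meet along the side `j` of the face `0`, and the faces `1` and
`2` meet along the side `j'` of the face `1`. -/
structure IsGluing (m : ℕ) (τ : ℕ × ℕ → ℕ × ℕ) (j j' : ℕ) : Prop where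
  fst_lt : ∀ d : ℕ × ℕ, d.1 < 3 → d.2 < m → (τ d).1 < 3
  snd_lt : ∀ d : ℕ × ℕ, d.1 < 3 → d.2 < m → (τ d).2 < m
  invol : ∀ d : ℕ × ℕ, d.1 < 3 → d.2 < m → τ (τ d) = d
  corner : ∀ d : ℕ × ℕ, d.1 < 3 → d.2 < m → ∃ d' d'', IsVertex m τ d d' d''
  lt : j < m
  lt' : j' < m
  fst_eq : (τ (0, j)).1 = 1
  fst_eq' : (τ (1, j')).1 = 2

/-- The relations satisfied by the labels of a gluing of three `m`-gons. -/
structure IsLabelling {H : Type*} [Group H] (m : ℕ) (τ : ℕ × ℕ → ℕ × ℕ) (j j' : ℕ)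
    (e : ℕ × ℕ → H) : Prop where
  inv : ∀ d : ℕ × ℕ, d.1 < 3 → d.2 < m → e (τ d) * e d = 1
  corner : ∀ d d' d'' : ℕ × ℕ, d.1 < 3 → d.2 < m → IsVertex m τ d d' d'' →
    e d'' * (e d' * e d) = 1
  eq_one : e (0, j) = 1
  eq_one' : e (1, j') = 1

theorem exists_hom_of_triangle {m : ℕ} {N : Fin 3 → Fin 3 → ℕ}
    (hsymm : ∀ i j, N i j = N j i) (h01 : N 0 1 = m) (h12 : N 1 2 = 3)
    (h02 : N 0 2 = 2) {H : Type*} [Group H] {R Y : H} (hR : R ^ m = 1) (hY : Y * Y = 1)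
    (hRY : (R * Y) ^ 3 = 1) :
    ∃ φ : EvenGroup N 0 →* H, φ (EvenGroup.of 1) = R⁻¹ ∧ φ (EvenGroup.of 2) = Y := by
  have hYinv : Y⁻¹ = Y := inv_eq_of_mul_eq_one_left hY
  have hYR : (Y * R⁻¹) ^ 3 = 1 := by
    rw [← inv_inj, ← inv_pow, mul_inv_rev, inv_inv, hYinv, hRY, inv_one]
  refine ⟨EvenGroup.lift ![1, R⁻¹, Y] rfl ?_, EvenGroup.lift_of _ _ _ _, EvenGroup.lift_of _ _ _ _⟩
  intro i j
  fin_cases i <;> fin_cases j <;> dsimp only [Fin.zero_eta, Fin.mk_one, Fin.reduceFinMk]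
  · simp
  · simp [h01, hR]
  · simp [h02, sq, hY]
  · simp [hsymm 1, h01, hR]
  · simp
  · simp [h12, hRY]
  · simp [hsymm 2, h02, sq, hYinv, hY]
  · simp [hsymm 2, h12, hYinv, hYR]
  · simp

theorem IsVertex.unique {m : ℕ} {τ : ℕ × ℕ → ℕ × ℕ} {d d' d'' c' c'' : ℕ × ℕ}
    (h : IsVertex m τ d d' d'') (h' : IsVertex m τ d c' c'') : d' = c' ∧ d'' = c'' := by
  have h1 : d' = c' := h.fst.symm.trans h'.fst
  exact ⟨h1, h.snd.symm.trans (h1 ▸ h'.snd)⟩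

theorem nextSide_iterate_self {m : ℕ} {d : ℕ × ℕ} (hd : d.2 < m) :
    (nextSide m)^[m] d = d := by
  rw [iterate_nextSide m m hd, Nat.add_mod_right, Nat.mod_eq_of_lt hd]

theorem nextSide_snd_lt {m : ℕ} {d : ℕ × ℕ} (hd : d.2 < m) : (nextSide m d).2 < m :=
  Nat.mod_lt _ (by omega)

theorem prevSide_snd_lt {m : ℕ} {d : ℕ × ℕ} (hd : d.2 < m) :
    ((nextSide m)^[m - 1] d).2 < m := by
  rw [iterate_nextSide _ _ hd]
  exact Nat.mod_lt _ (by omega)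

theorem nextSide_prevSide {m : ℕ} {d : ℕ × ℕ} (hd : d.2 < m) :
    nextSide m ((nextSide m)^[m - 1] d) = d := by
  rw [← Function.iterate_succ_apply' (nextSide m), show (m - 1).succ = m by omega,
    nextSide_iterate_self hd]

theorem prevSide_nextSide {m : ℕ} {d : ℕ × ℕ} (hd : d.2 < m) :
    (nextSide m)^[m - 1] (nextSide m d) = d := by
  rw [← Function.iterate_succ_apply, show (m - 1).succ = m by omega, nextSide_iterate_self hd]

/-- The sides of three `m`-gons. -/
abbrev Dart (m : ℕ) : Type := {d : ℕ × ℕ // d.1 < 3 ∧ d.2 < m}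

instance (m : ℕ) : Finite (Dart m) :=
  Finite.of_injective (fun d : Dart m => ((⟨d.1.1, d.2.1⟩, ⟨d.1.2, d.2.2⟩) : Fin 3 × Fin m))
    fun d d' h => by
      simp only [Prod.mk.injEq, Fin.mk.injEq] at h
      exact Subtype.ext (Prod.ext h.1 h.2)

/-- The simultaneous rotation of three `m`-gons. -/
def faceRotation (m : ℕ) (K : Type*) : Equiv.Perm (Dart m × K) where
  toFun y := (⟨nextSide m y.1, y.1.2.1, nextSide_snd_lt y.1.2.2⟩, y.2)
  invFun y := (⟨(nextSide m)^[m - 1] y.1, by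
    rw [iterate_nextSide _ _ y.1.2.2]
    exact y.1.2.1, prevSide_snd_lt y.1.2.2⟩, y.2)
  left_inv y := Prod.ext (Subtype.ext (prevSide_nextSide y.1.2.2)) rfl
  right_inv y := Prod.ext (Subtype.ext (nextSide_prevSide y.1.2.2)) rfl

theorem faceRotation_pow_apply (m k : ℕ) {K : Type*} (d : Dart m) (g : K) :
    (faceRotation m K ^ k) (d, g) = (⟨(d.1.1, (d.1.2 + k) % m), d.2.1,
      Nat.mod_lt _ (Nat.zero_lt_of_lt d.2.2)⟩, g) := by
  induction k with
  | zero => simp [Nat.mod_eq_of_lt d.2.2]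
  | succ k ih =>
    rw [pow_succ', Equiv.Perm.mul_apply, ih]
    simp [faceRotation, nextSide, add_assoc]

theorem faceRotation_pow_self (m : ℕ) (K : Type*) : faceRotation m K ^ m = 1 := by
  ext1 ⟨d, g⟩
  simp [faceRotation_pow_apply, Nat.mod_eq_of_lt d.2.2]

theorem EvenGroup.commensurable_of_gluing {m : ℕ} {N : Fin 3 → Fin 3 → ℕ}
    (hsymm : ∀ i j, N i j = N j i) (h01 : N 0 1 = m) (h12 : N 1 2 = 3) (h02 : N 0 2 = 2)
    {K : Type*} [Group K] {τ : ℕ × ℕ → ℕ × ℕ} {j j' : ℕ} (hτ : IsGluing m τ j j')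
    {e : ℕ × ℕ → K} (he : IsLabelling m τ j j' e)
    (hgen : Subgroup.closure (e '' {d | d.1 < 3 ∧ d.2 < m}) = ⊤)
    (hlift : ∀ E : ℕ × ℕ → EvenGroup N 0, IsLabelling m τ j j' E →
      ∃ ψ : K →* EvenGroup N 0, ∀ d : ℕ × ℕ, d.1 < 3 → d.2 < m → ψ (e d) = E d) :
    AbstractlyCommensurable (EvenGroup N 0) K := by
  let Y : Equiv.Perm (Dart m × K) := labelledInvolution
    (fun d => ⟨τ d, hτ.fst_lt d d.2.1 d.2.2, hτ.snd_lt d d.2.1 d.2.2⟩) (fun d => e d)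
    (fun d => Subtype.ext (hτ.invol d d.2.1 d.2.2)) (fun d => he.inv d d.2.1 d.2.2)
  have hRY : (faceRotation m K * Y) ^ 3 = 1 := by
    ext1 ⟨⟨d, hd⟩, k⟩
    obtain ⟨d', d'', h⟩ := hτ.corner d hd.1 hd.2
    have h1 := he.corner d d' d'' hd.1 hd.2 h
    obtain ⟨rfl, rfl, h2⟩ := h
    rw [pow_succ, sq]
    refine Prod.ext (Subtype.ext h2) ?_
    change e _ * (e _ * (e _ * k)) = k
    rw [← mul_assoc (e _) (e _) k, ← mul_assoc]
    exact (congrArg (· * k) h1).trans (one_mul k)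
  obtain ⟨ρ, hρ1, hρ2⟩ := exists_hom_of_triangle hsymm h01 h12 h02 (faceRotation_pow_self m K)
    (labelledInvolution_mul_self _ _ _ _ : Y * Y = 1) hRY
  obtain ⟨r, hr⟩ : ∃ r : EvenGroup N 0, r = (of 1)⁻¹ := ⟨_, rfl⟩
  obtain ⟨x, hx⟩ : ∃ x : EvenGroup N 0, x = of 2 := ⟨_, rfl⟩
  have hrm : r ^ m = 1 := by
    have h := inv_of_mul_of_pow (N := N) (o := 0) 1 0
    rwa [of_base, mul_one, hsymm, h01, ← hr] at h
  have hxx : x * x = 1 := by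
    have h := inv_of_mul_of_pow (N := N) (o := 0) 0 2
    rwa [of_base, inv_one, one_mul, h02, ← hx, sq] at h
  have hrx : (r * x) ^ 3 = 1 := by
    have h := inv_of_mul_of_pow (N := N) (o := 0) 1 2
    rwa [h12, ← hr, ← hx] at h
  have hρr : ρ r = faceRotation m K := by rw [hr, map_inv, hρ1, inv_inv]
  have hρx : ρ x = Y := by rw [hx, hρ2]
  let δ₁ : EvenGroup N 0 := (r ^ (τ (0, j)).2)⁻¹ * (x * r ^ j)
  let δ : ℕ → EvenGroup N 0 := fun a =>
    if a = 0 then 1 else if a = 1 then δ₁ else (r ^ (τ (1, j')).2)⁻¹ * (x * (r ^ j' * δ₁))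
  let t : ℕ × ℕ → EvenGroup N 0 := fun d => r ^ d.2 * δ d.1
  have ht : ∀ d, t (nextSide m d) = r * t d := by
    intro d
    simp only [t, nextSide]
    rw [← pow_eq_pow_mod _ hrm, pow_succ', mul_assoc]
  let E : ℕ × ℕ → EvenGroup N 0 := fun d => (t (τ d))⁻¹ * (x * t d)
  have hE : ∀ d d', nextSide m (τ d) = d' → r * x * t d = t d' * E d := by
    rintro d _ rfl
    rw [ht]
    simp only [E, mul_assoc, mul_inv_cancel_left]
  have hEl : IsLabelling m τ j j' E := by
    refine ⟨fun d h1 h2 => ?_, fun d d' d'' _ _ h => ?_, ?_, ?_⟩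
    · simp only [E, hτ.invol d h1 h2, mul_assoc, mul_inv_cancel_left]
      rw [← mul_assoc x x, hxx, one_mul, inv_mul_cancel]
    · have h1 : (r * x) ^ 3 * t d = t d * (E d'' * (E d' * E d)) := by
        rw [pow_succ, sq, mul_assoc _ _ (t d), hE _ _ h.fst, mul_assoc, ← mul_assoc _ (t d'),
          hE _ _ h.snd, mul_assoc (t d''), ← mul_assoc _ (t d''), hE _ _ h.trd, mul_assoc]
      rw [hrx, one_mul] at h1
      exact (left_eq_mul.1 h1)
    · simp only [E, t, hτ.fst_eq, δ, δ₁]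
      simp
    · simp only [E, t, hτ.fst_eq', δ, δ₁]
      simp
  obtain ⟨ψ, hψ⟩ := hlift E hEl
  have hm : 0 < m := Nat.zero_lt_of_lt hτ.lt
  let x₀ : Dart m := ⟨(0, 0), by norm_num, hm⟩
  have hρδ : ∀ a (ha : a < 3) k, ρ (δ a) (x₀, k) = (⟨(a, 0), ha, hm⟩, k) := by
    have hr : ∀ (i : ℕ) (d : Dart m) k, d.1.2 = 0 → ∀ hi : i < m, ρ (r ^ i) (d, k) =
        (⟨(d.1.1, i), d.2.1, hi⟩, k) := by
      intro i d k hd hi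
      rw [map_pow, hρr, faceRotation_pow_apply]
      simp [hd, Nat.mod_eq_of_lt hi]
    have hstep : ∀ (a j : ℕ) (ha : a < 3) (hj : j < m) k, e (a, j) = 1 →
        ρ ((r ^ (τ (a, j)).2)⁻¹ * (x * r ^ j)) (⟨(a, 0), ha, hm⟩, k) =
          (⟨((τ (a, j)).1, 0), hτ.fst_lt (a, j) ha hj, hm⟩, k) := by
      intro a j ha hj k h
      rw [map_mul, map_inv, Equiv.Perm.mul_apply, Equiv.Perm.inv_eq_iff_eq,
        hr _ _ _ rfl (hτ.snd_lt (a, j) ha hj), map_mul, Equiv.Perm.mul_apply,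
        hr _ _ _ rfl hj, hρx]
      refine Prod.ext rfl ?_
      change e (a, j) * k = k
      rw [h, one_mul]
    have h1 : ∀ k, ρ δ₁ (x₀, k) = (⟨(1, 0), by norm_num, hm⟩, k) := fun k => by
      refine (hstep 0 j (by norm_num) hτ.lt k he.eq_one).trans ?_
      simp only [hτ.fst_eq]
    intro a ha k
    interval_cases a
    · simp [δ, x₀]
    · exact h1 k
    · have h2 : δ 2 = (r ^ (τ (1, j')).2)⁻¹ * (x * r ^ j') * δ₁ := by
        simp [δ, mul_assoc]
      rw [h2, map_mul, Equiv.Perm.mul_apply, h1]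
      refine (hstep 1 j' (by norm_num) hτ.lt' k he.eq_one').trans ?_
      simp only [hτ.fst_eq']
  have hρt : ∀ (d : Dart m) k, ρ (t d) (x₀, k) = (d, k) := by
    intro d k
    simp only [t]
    rw [map_mul, Equiv.Perm.mul_apply, hρδ _ d.2.1, map_pow, hρr, faceRotation_pow_apply]
    simp [Nat.mod_eq_of_lt d.2.2]
  refine .of_injective_left (injective_and_finiteIndex_range_of_action ψ ρ x₀
    (fun d : Dart m => t d) hgen closure_range_of ?_ ?_ ?_)
  · rintro _ ⟨d, hd, rfl⟩ k
    rw [hψ d hd.1 hd.2]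
    exact perm_conj_apply ρ (x := ⟨d, hd⟩)
      (x' := ⟨τ d, hτ.fst_lt d hd.1 hd.2, hτ.snd_lt d hd.1 hd.2⟩)
      (hρt _) (hρt ⟨τ d, hτ.fst_lt d hd.1 hd.2, hτ.snd_lt d hd.1 hd.2⟩)
      (fun k => by rw [hρx]; rfl) k
  · simp [t, δ, x₀]
  · rintro _ ⟨i, rfl⟩ ⟨d, hd⟩
    fin_cases i
    · refine ⟨⟨d, hd⟩, ?_⟩
      change (t d)⁻¹ * (of 0 * t d) ∈ _
      rw [of_base, one_mul, inv_mul_cancel]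
      exact one_mem _
    · refine ⟨⟨(nextSide m)^[m - 1] d, ?_, prevSide_snd_lt hd.2⟩, ?_⟩
      · rw [iterate_nextSide _ _ hd.2]
        exact hd.1
      · change (t ((nextSide m)^[m - 1] d))⁻¹ * (of 1 * t d) ∈ _
        have h := ht ((nextSide m)^[m - 1] d)
        rw [nextSide_prevSide hd.2, hr] at h
        rw [h, mul_inv_cancel_left, inv_mul_cancel]
        exact one_mem _
    · refine ⟨⟨τ d, hτ.fst_lt d hd.1 hd.2, hτ.snd_lt d hd.1 hd.2⟩, ?_⟩
      change (t (τ d))⁻¹ * (of 2 * t d) ∈ _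
      rw [← hx]
      exact ⟨e d, hψ d hd.1 hd.2⟩

theorem IsLabelling.of_exists {H : Type*} [Group H] {m : ℕ} {τ : ℕ × ℕ → ℕ × ℕ} {j j' : ℕ}
    {e : ℕ × ℕ → H} (hinv : ∀ d : ℕ × ℕ, d.1 < 3 → d.2 < m → e (τ d) * e d = 1)
    (h : ∀ d : ℕ × ℕ, d.1 < 3 → d.2 < m →
      ∃ d' d'', IsVertex m τ d d' d'' ∧ e d'' * (e d' * e d) = 1)
    (hj : e (0, j) = 1) (hj' : e (1, j') = 1) : IsLabelling m τ j j' e where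
  inv := hinv
  corner d d' d'' h1 h2 hd := by
    obtain ⟨c', c'', hc, he⟩ := h d h1 h2
    obtain ⟨rfl, rfl⟩ := hd.unique hc
    exact he
  eq_one := hj
  eq_one' := hj'

theorem mul_mul_eq_one_rotate {H : Type*} [Group H] {a b c : H} (h : a * (b * c) = 1) :
    c * (a * b) = 1 := by
  rw [← mul_assoc] at h
  rw [eq_inv_of_mul_eq_one_right h, inv_mul_cancel]

theorem nextSide_of_lt {m a i : ℕ} (h : i + 1 < m) : nextSide m (a, i) = (a, i + 1) := by
  rw [nextSide, Nat.mod_eq_of_lt h]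

theorem nextSide_last {m a i : ℕ} (h : i + 1 = m) : nextSide m (a, i) = (a, 0) := by
  rw [nextSide, h, Nat.mod_self]

namespace EvenGluing

/-- A gluing of three `(2 * p + 2)`-gons to a sphere with `2 * p` folded sides. -/
def glue (p : ℕ) (d : ℕ × ℕ) : ℕ × ℕ :=
  if d.1 = 0 then (if d.2 ≤ p then (1, 2 * (p - d.2)) else (2, 2 * (2 * p + 1 - d.2)))
  else if d.2 = 2 * p + 1 then (3 - d.1, d.2)
  else if d.2 % 2 = 1 then d
  else if d.1 = 1 then (0, p - d.2 / 2) else (0, 2 * p + 1 - d.2 / 2)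

/-- The labels of the sides of three glued `(2 * p + 2)`-gons. -/
def label {H : Type*} [Group H] (p : ℕ) (γ : ℕ → H) (d : ℕ × ℕ) : H :=
  if d.1 = 0 then (if d.2 ≤ p then (γ d.2)⁻¹ else (γ (d.2 - 1))⁻¹)
  else if d.2 = 2 * p + 1 then 1
  else if d.2 % 2 = 1 then
    (γ (d.1 * p - d.2 / 2 - 1))⁻¹ * γ (d.1 * p - d.2 / 2)
  else γ (d.1 * p - d.2 / 2)

theorem dart_cases {p : ℕ} {Q : ℕ × ℕ → Prop} (h0 : ∀ t s, t + s = p → Q (0, t))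
    (h0' : ∀ t s, t + s = p → Q (0, p + 1 + t)) (h1 : ∀ t s, t + s = p → Q (1, 2 * s))
    (h1' : ∀ t s, t + s + 1 = p → Q (1, 2 * s + 1)) (h1e : Q (1, 2 * p + 1))
    (h2 : ∀ t s, t + s = p → Q (2, 2 * s)) (h2' : ∀ t s, t + s + 1 = p → Q (2, 2 * s + 1))
    (h2e : Q (2, 2 * p + 1)) (d : ℕ × ℕ) (hd : d.1 < 3) (hd' : d.2 < 2 * p + 2) : Q d := by
  obtain ⟨a, i⟩ := d
  dsimp only at hd hd'
  interval_cases a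
  · rcases le_or_gt i p with h | h
    · exact h0 i (p - i) (by omega)
    · obtain ⟨t, rfl⟩ := Nat.exists_eq_add_of_le h
      exact h0' t (p - t) (by omega)
  · rcases Nat.even_or_odd' i with ⟨s, rfl | rfl⟩
    · exact h1 (p - s) s (by omega)
    · rcases eq_or_ne s p with rfl | h
      · exact h1e
      · exact h1' (p - s - 1) s (by omega)
  · rcases Nat.even_or_odd' i with ⟨s, rfl | rfl⟩
    · exact h2 (p - s) s (by omega)
    · rcases eq_or_ne s p with rfl | h
      · exact h2e
      · exact h2' (p - s - 1) s (by omega)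

section glue

variable {p s t : ℕ}

theorem glue_zero (h : t + s = p) : glue p (0, t) = (1, 2 * s) := by
  simp [glue]; grind

theorem glue_zero' (h : t + s = p) : glue p (0, p + 1 + t) = (2, 2 * s) := by
  simp [glue]; grind

theorem glue_one (h : t + s = p) : glue p (1, 2 * s) = (0, t) := by
  simp [glue]; grind

theorem glue_one_start : glue p (1, 0) = (0, p) := glue_one (s := 0) (add_zero p)

theorem glue_one_odd (h : t + s + 1 = p) : glue p (1, 2 * s + 1) = (1, 2 * s + 1) := by
  simp [glue]; grind

theorem glue_one_last : glue p (1, 2 * p + 1) = (2, 2 * p + 1) := by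
  simp [glue]

theorem glue_two (h : t + s = p) : glue p (2, 2 * s) = (0, p + 1 + t) := by
  simp [glue]; grind

theorem glue_two_start : glue p (2, 0) = (0, p + 1 + p) := glue_two (s := 0) (add_zero p)

theorem glue_two_odd (h : t + s + 1 = p) : glue p (2, 2 * s + 1) = (2, 2 * s + 1) := by
  simp [glue]; grind

theorem glue_two_last : glue p (2, 2 * p + 1) = (1, 2 * p + 1) := by
  simp [glue]

variable {H : Type*} [Group H] {γ : ℕ → H}

theorem label_zero (h : t + s = p) : label p γ (0, t) = (γ t)⁻¹ := by
  rw [label, if_pos rfl, if_pos (by dsimp only; omega)]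

theorem label_zero' : label p γ (0, p + 1 + t) = (γ (p + t))⁻¹ := by
  rw [label, if_pos rfl, if_neg (by dsimp only; omega),
    show p + 1 + t - 1 = p + t by omega]

theorem label_one (h : t + s = p) : label p γ (1, 2 * s) = γ t := by
  simp [label]; grind

theorem label_one_start : label p γ (1, 0) = γ p := label_one (s := 0) (add_zero p)

theorem label_one_odd (h : t + s + 1 = p) :
    label p γ (1, 2 * s + 1) = (γ t)⁻¹ * γ (t + 1) := by
  have h1 : 1 * p - (2 * s + 1) / 2 - 1 = t := by omega
  have h2 : 1 * p - (2 * s + 1) / 2 = t + 1 := by omega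
  rw [label, if_neg (by simp), if_neg (by dsimp only; omega), if_pos (by dsimp only; omega), h1, h2]

theorem label_one_last : label p γ (1, 2 * p + 1) = 1 := by
  simp [label]

theorem label_two (h : t + s = p) : label p γ (2, 2 * s) = γ (p + t) := by
  simp [label]; grind

theorem label_two_start : label p γ (2, 0) = γ (p + p) := label_two (s := 0) (add_zero p)

theorem label_two_odd (h : t + s + 1 = p) :
    label p γ (2, 2 * s + 1) = (γ (p + t))⁻¹ * γ (p + t + 1) := by
  have h1 : 2 * p - (2 * s + 1) / 2 - 1 = p + t := by omega
  have h2 : 2 * p - (2 * s + 1) / 2 = p + t + 1 := by omega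
  rw [label, if_neg (by simp), if_neg (by dsimp only; omega), if_pos (by dsimp only; omega), h1, h2]

theorem label_two_last : label p γ (2, 2 * p + 1) = 1 := by
  simp [label]

theorem vertex_zero : IsVertex (2 * p + 2) (glue p) (0, 0) (1, 2 * p + 1) (2, 0) where
  fst := by rw [glue_zero (zero_add p), nextSide_of_lt (by omega)]
  snd := by rw [glue_one_last, nextSide_last (by omega)]
  trd := by rw [glue_two_start, nextSide_last (by omega)]

theorem vertex_one (h : t + s + 1 = p) :
    IsVertex (2 * p + 2) (glue p) (0, t + 1) (1, 2 * s + 1) (1, 2 * (s + 1)) where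
  fst := by rw [glue_zero (s := s) (by omega), nextSide_of_lt (by omega)]
  snd := by rw [glue_one_odd h, nextSide_of_lt (by omega)]; rfl
  trd := by rw [glue_one (t := t) (by omega), nextSide_of_lt (by omega)]

theorem vertex_two : IsVertex (2 * p + 2) (glue p) (0, p + 1) (2, 2 * p + 1) (1, 0) where
  fst := by rw [glue_zero' (t := 0) (zero_add p), nextSide_of_lt (by omega)]
  snd := by rw [glue_two_last, nextSide_last (by omega)]
  trd := by rw [glue_one_start, nextSide_of_lt (by omega)]

theorem vertex_three (h : t + s + 1 = p) :
    IsVertex (2 * p + 2) (glue p) (0, p + 1 + (t + 1)) (2, 2 * s + 1) (2, 2 * (s + 1)) where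
  fst := by rw [glue_zero' (s := s) (by omega), nextSide_of_lt (by omega)]
  snd := by rw [glue_two_odd h, nextSide_of_lt (by omega)]; rfl
  trd := by rw [glue_two (t := t) (by omega), nextSide_of_lt (by omega)]; rfl

end glue

theorem exists_vertex {p : ℕ} {Q : ℕ × ℕ → ℕ × ℕ → ℕ × ℕ → Prop}
    (hQ : ∀ d d' d'', Q d d' d'' → Q d' d'' d) (h0 : Q (0, 0) (1, 2 * p + 1) (2, 0))
    (h1 : ∀ t s, t + s + 1 = p → Q (0, t + 1) (1, 2 * s + 1) (1, 2 * (s + 1)))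
    (h2 : Q (0, p + 1) (2, 2 * p + 1) (1, 0))
    (h3 : ∀ t s, t + s + 1 = p → Q (0, p + 1 + (t + 1)) (2, 2 * s + 1) (2, 2 * (s + 1))) :
    ∀ d : ℕ × ℕ, d.1 < 3 → d.2 < 2 * p + 2 →
      ∃ d' d'', IsVertex (2 * p + 2) (glue p) d d' d'' ∧ Q d d' d'' := by
  have key : ∀ d d' d'', IsVertex (2 * p + 2) (glue p) d d' d'' → Q d d' d'' →
      (∃ c' c'', IsVertex (2 * p + 2) (glue p) d c' c'' ∧ Q d c' c'') ∧
      (∃ c' c'', IsVertex (2 * p + 2) (glue p) d' c' c'' ∧ Q d' c' c'') ∧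
      ∃ c' c'', IsVertex (2 * p + 2) (glue p) d'' c' c'' ∧ Q d'' c' c'' :=
    fun d d' d'' h hq => ⟨⟨d', d'', h, hq⟩, ⟨d'', d, h.rotate, hQ _ _ _ hq⟩,
      ⟨d, d', h.rotate.rotate, hQ _ _ _ (hQ _ _ _ hq)⟩⟩
  have k0 := key _ _ _ vertex_zero h0
  have k1 := fun t s h => key _ _ _ (vertex_one h) (h1 t s h)
  have k2 := key _ _ _ vertex_two h2
  have k3 := fun t s h => key _ _ _ (vertex_three h) (h3 t s h)
  refine dart_cases ?_ ?_ ?_ ?_ k0.2.1 ?_ ?_ k2.2.1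
  · rintro (_ | t) s h
    · exact k0.1
    · exact (k1 t s (by omega)).1
  · rintro (_ | t) s h
    · exact k2.1
    · exact (k3 t s (by omega)).1
  · rintro t (_ | s) h
    · exact k2.2.2
    · exact (k1 t s (by omega)).2.2
  · exact fun t s h => (k1 t s h).2.1
  · rintro t (_ | s) h
    · exact k0.2.2
    · exact (k3 t s (by omega)).2.2
  · exact fun t s h => (k3 t s h).2.1

theorem isGluing (p : ℕ) : IsGluing (2 * p + 2) (glue p) 0 (2 * p + 1) where
  fst_lt := by
    refine dart_cases ?_ ?_ ?_ ?_ ?_ ?_ ?_ ?_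
    · intro t s h; rw [glue_zero h]; norm_num
    · intro t s h; rw [glue_zero' h]; norm_num
    · intro t s h; rw [glue_one h]; norm_num
    · intro t s h; rw [glue_one_odd h]; norm_num
    · rw [glue_one_last]; norm_num
    · intro t s h; rw [glue_two h]; norm_num
    · intro t s h; rw [glue_two_odd h]; norm_num
    · rw [glue_two_last]; norm_num
  snd_lt := by
    refine dart_cases ?_ ?_ ?_ ?_ ?_ ?_ ?_ ?_
    · intro t s h; rw [glue_zero h]; dsimp only; omega
    · intro t s h; rw [glue_zero' h]; dsimp only; omega
    · intro t s h; rw [glue_one h]; dsimp only; omega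
    · intro t s h; rw [glue_one_odd h]; dsimp only; omega
    · rw [glue_one_last]; dsimp only; omega
    · intro t s h; rw [glue_two h]; dsimp only; omega
    · intro t s h; rw [glue_two_odd h]; dsimp only; omega
    · rw [glue_two_last]; dsimp only; omega
  invol := by
    refine dart_cases ?_ ?_ ?_ ?_ ?_ ?_ ?_ ?_
    · intro t s h; rw [glue_zero h, glue_one h]
    · intro t s h; rw [glue_zero' h, glue_two h]
    · intro t s h; rw [glue_one h, glue_zero h]
    · intro t s h; rw [glue_one_odd h, glue_one_odd h]
    · rw [glue_one_last, glue_two_last]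
    · intro t s h; rw [glue_two h, glue_zero' h]
    · intro t s h; rw [glue_two_odd h, glue_two_odd h]
    · rw [glue_two_last, glue_one_last]
  corner d h h' := by
    obtain ⟨d', d'', hd, -⟩ := exists_vertex (Q := fun _ _ _ => True) (fun _ _ _ h => h) trivial
      (fun _ _ _ => trivial) trivial (fun _ _ _ => trivial) d h h'
    exact ⟨d', d'', hd⟩
  lt := by omega
  lt' := by omega
  fst_eq := by rw [glue_zero (zero_add p)]
  fst_eq' := by rw [glue_one_last]

theorem isLabelling {H : Type*} [Group H] {p : ℕ} {γ : ℕ → H}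
    (hγ : IsEvenPolygonFamily (2 * p) γ) :
    IsLabelling (2 * p + 2) (glue p) 0 (2 * p + 1) (label p γ) := by
  refine .of_exists ?_ (exists_vertex (fun _ _ _ => mul_mul_eq_one_rotate) ?_ ?_ ?_ ?_) ?_ ?_
  · refine dart_cases ?_ ?_ ?_ ?_ ?_ ?_ ?_ ?_
    · intro t s h; rw [glue_zero h, label_zero h, label_one h, mul_inv_cancel]
    · intro t s h; rw [glue_zero' h, label_zero', label_two h, mul_inv_cancel]
    · intro t s h; rw [glue_one h, label_zero h, label_one h, inv_mul_cancel]
    · intro t s h; rw [glue_one_odd h, label_one_odd h, hγ.sq _ (by omega)]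
    · rw [glue_one_last, label_one_last, label_two_last, one_mul]
    · intro t s h; rw [glue_two h, label_zero', label_two h, inv_mul_cancel]
    · intro t s h; rw [glue_two_odd h, label_two_odd h, hγ.sq _ (by omega)]
    · rw [glue_two_last, label_one_last, label_two_last, one_mul]
  · rw [label_zero (zero_add p), label_one_last, label_two_start, ← two_mul,
      hγ.zero, hγ.last, one_mul, inv_one, one_mul]
  · intro t s h
    rw [label_zero (s := s) (by omega), label_one_odd h, label_one (t := t) (by omega),
      mul_inv_cancel_right, mul_inv_cancel]
  · rw [show (0, p + 1) = (0, p + 1 + 0) from rfl, label_zero', label_two_last,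
      label_one_start, one_mul, add_zero, mul_inv_cancel]
  · intro t s h
    rw [label_zero', label_two_odd h, label_two (t := t) (by omega), ← add_assoc,
      mul_inv_cancel_right, mul_inv_cancel]
  · rw [label_zero (zero_add p), hγ.zero, inv_one]
  · rw [label_one_last]

theorem exists_family {H : Type*} [Group H] {p : ℕ} {E : ℕ × ℕ → H}
    (hE : IsLabelling (2 * p + 2) (glue p) 0 (2 * p + 1) E) :
    ∃ γ, IsEvenPolygonFamily (2 * p) γ ∧
      ∀ d : ℕ × ℕ, d.1 < 3 → d.2 < 2 * p + 2 → label p γ d = E d := by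
  have c0 := hE.corner _ _ _ (by norm_num) (by norm_num) vertex_zero
  have c1 := fun t s h => hE.corner _ _ _ (by norm_num) (by simp; omega)
    (vertex_one (p := p) (t := t) (s := s) h)
  have c2 := hE.corner _ _ _ (by norm_num) (by simp; omega) vertex_two
  have c3 := fun t s h => hE.corner _ _ _ (by norm_num) (by simp; omega)
    (vertex_three (p := p) (t := t) (s := s) h)
  obtain ⟨γ, hγ⟩ : ∃ γ : ℕ → H, γ = fun i =>
      if i ≤ p then E (1, 2 * (p - i)) else E (2, 2 * (2 * p - i)) := ⟨_, rfl⟩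
  have e2e : E (2, 2 * p + 1) = 1 := by
    have h := hE.inv (1, 2 * p + 1) (by norm_num) (by simp)
    rwa [glue_one_last, hE.eq_one', mul_one] at h
  have e0 : ∀ t s, t + s = p → E (0, t) = (E (1, 2 * s))⁻¹ := fun t s h => by
    have h1 := hE.inv (1, 2 * s) (by norm_num) (by simp; omega)
    rw [glue_one h] at h1
    exact eq_inv_of_mul_eq_one_left h1
  have e0' : ∀ t s, t + s = p → E (0, p + 1 + t) = (E (2, 2 * s))⁻¹ := fun t s h => by
    have h1 := hE.inv (2, 2 * s) (by norm_num) (by simp; omega)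
    rw [glue_two h] at h1
    exact eq_inv_of_mul_eq_one_left h1
  have g1 : ∀ t s, t + s = p → γ t = E (1, 2 * s) := fun t s h => by
    rw [hγ]
    dsimp only
    rw [if_pos (by omega), show p - t = s by omega]
  have g2 : ∀ t s, t + s = p → γ (p + t) = E (2, 2 * s) := fun t s h => by
    rcases t with _ | t
    · obtain rfl : s = p := by omega
      rw [show (0, s + 1) = (0, s + 1 + 0) from rfl, e2e, one_mul, e0' 0 s h] at c2
      rw [add_zero, g1 s 0 (add_zero s)]
      exact mul_inv_eq_one.1 c2
    · rw [hγ]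
      dsimp only
      rw [if_neg (by omega), show 2 * p - (p + (t + 1)) = s by omega]
  have f1 : ∀ t s, t + s + 1 = p → (γ t)⁻¹ * γ (t + 1) = E (1, 2 * s + 1) := fun t s h => by
    have h1 := c1 t s h
    rw [e0 (t + 1) s (by omega), ← g1 t _ (by omega), ← g1 (t + 1) _ (by omega)] at h1
    rw [← eq_inv_of_mul_eq_one_right h1, inv_mul_cancel_right]
  have f2 : ∀ t s, t + s + 1 = p → (γ (p + t))⁻¹ * γ (p + t + 1) = E (2, 2 * s + 1) :=
    fun t s h => by
    have h1 := c3 t s h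
    rw [e0' (t + 1) s (by omega), ← g2 t _ (by omega), ← g2 (t + 1) _ (by omega)] at h1
    rw [← eq_inv_of_mul_eq_one_right h1, ← add_assoc, inv_mul_cancel_right]
  refine ⟨γ, ⟨?_, ?_, ?_⟩, dart_cases ?_ ?_ ?_ ?_ ?_ ?_ ?_ ?_⟩
  · rw [g1 0 p (by omega), ← inv_inj, ← e0 0 p (by omega), hE.eq_one, inv_one]
  · rw [two_mul, g2 p 0 (add_zero p)]
    rwa [hE.eq_one, hE.eq_one', mul_one, mul_one] at c0
  · intro i hi
    rcases lt_or_ge i p with h | h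
    · obtain ⟨s, hs⟩ := Nat.exists_eq_add_of_lt h
      rw [f1 i s hs.symm]
      have h1 := hE.inv (1, 2 * s + 1) (by norm_num) (by simp; omega)
      rwa [glue_one_odd hs.symm] at h1
    · obtain ⟨t, rfl⟩ := Nat.exists_eq_add_of_le h
      obtain ⟨s, hs⟩ := Nat.exists_eq_add_of_lt (show t < p by omega)
      rw [f2 t s hs.symm]
      have h1 := hE.inv (2, 2 * s + 1) (by norm_num) (by simp; omega)
      rwa [glue_two_odd hs.symm] at h1
  · intro t s h; rw [label_zero h, e0 t s h, g1 t s h]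
  · intro t s h; rw [label_zero', e0' t s h, g2 t s h]
  · intro t s h; rw [label_one h, g1 t s h]
  · intro t s h; rw [label_one_odd h, f1 t s h]
  · rw [label_one_last, hE.eq_one']
  · intro t s h; rw [label_two h, g2 t s h]
  · intro t s h; rw [label_two_odd h, f2 t s h]
  · rw [label_two_last, e2e]

theorem map_label {G H : Type*} [Group G] [Group H] {p : ℕ} {γ : ℕ → G} {γ' : ℕ → H} {ψ : G →* H}
    (hψ : ∀ i ≤ 2 * p, ψ (γ i) = γ' i) :
    ∀ d : ℕ × ℕ, d.1 < 3 → d.2 < 2 * p + 2 → ψ (label p γ d) = label p γ' d := by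
  refine dart_cases ?_ ?_ ?_ ?_ ?_ ?_ ?_ ?_
  · intro t s h
    rw [label_zero h, label_zero h, map_inv, hψ _ (by omega)]
  · intro t s h
    rw [label_zero', label_zero', map_inv, hψ _ (by omega)]
  · intro t s h
    rw [label_one h, label_one h, hψ _ (by omega)]
  · intro t s h
    rw [label_one_odd h, label_one_odd h, map_mul, map_inv, hψ _ (by omega), hψ _ (by omega)]
  · rw [label_one_last, label_one_last, map_one]
  · intro t s h
    rw [label_two h, label_two h, hψ _ (by omega)]
  · intro t s h
    rw [label_two_odd h, label_two_odd h, map_mul, map_inv, hψ _ (by omega), hψ _ (by omega)]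
  · rw [label_two_last, label_two_last, map_one]

theorem commensurable {p : ℕ} {N : Fin 3 → Fin 3 → ℕ} (hsymm : ∀ i j, N i j = N j i)
    (h01 : N 0 1 = 2 * p + 2) (h12 : N 1 2 = 3) (h02 : N 0 2 = 2) :
    AbstractlyCommensurable (EvenGroup N 0) (EvenPolygonGroup (2 * p)) := by
  refine EvenGroup.commensurable_of_gluing hsymm h01 h12 h02 (isGluing p)
    (isLabelling EvenPolygonGroup.isEvenPolygonFamily) ?_ fun E hE => ?_
  · rw [eq_top_iff, ← EvenPolygonGroup.closure_of]
    refine Subgroup.closure_mono ?_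
    rintro _ ⟨i, hi, rfl⟩
    rw [Set.mem_Iio] at hi
    rcases le_or_gt i p with h | h
    · obtain ⟨s, hs⟩ := Nat.exists_eq_add_of_le h
      exact ⟨(1, 2 * s), ⟨by norm_num, by dsimp only; omega⟩, label_one hs.symm⟩
    · obtain ⟨t, rfl⟩ := Nat.exists_eq_add_of_le h.le
      obtain ⟨s, hs⟩ := Nat.exists_eq_add_of_le (show t ≤ p by omega)
      exact ⟨(2, 2 * s), ⟨by norm_num, by dsimp only; omega⟩, label_two hs.symm⟩
  · obtain ⟨γ, hγ, hγE⟩ := exists_family hE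
    obtain ⟨ψ, hψ⟩ := EvenPolygonGroup.exists_hom hγ
    exact ⟨ψ, fun d h h' => (map_label hψ d h h').trans (hγE d h h')⟩

end EvenGluing

namespace OddGluing

/-- A gluing of three `(2 * p + 3)`-gons to a sphere with `2 * p + 1` folded sides. -/
def glue (p : ℕ) (d : ℕ × ℕ) : ℕ × ℕ :=
  if d.1 = 0 then
    if d.2 < p then (1, 2 * (p - d.2) - 1)
    else if d.2 = p then d
    else if d.2 = p + 1 then (1, 0)
    else (2, 2 * (2 * p + 2 - d.2))
  else if d.1 = 1 then
    if d.2 = 0 then (0, p + 1)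
    else if d.2 = 2 * p then (2, 2 * p + 2)
    else if d.2 = 2 * p + 1 then d
    else if d.2 = 2 * p + 2 then (2, 2 * p + 1)
    else if d.2 % 2 = 0 then d
    else (0, p - 1 - d.2 / 2)
  else
    if d.2 = 2 * p + 1 then (1, 2 * p + 2)
    else if d.2 = 2 * p + 2 then (1, 2 * p)
    else if d.2 % 2 = 1 then d
    else (0, 2 * p + 2 - d.2 / 2)

/-- The labels of the sides of three glued `(2 * p + 3)`-gons. -/
def label {H : Type*} [Group H] (p : ℕ) (γ : ℕ → H) (d : ℕ × ℕ) : H :=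
  if d.1 = 0 then
    if d.2 < p then (γ d.2)⁻¹
    else if d.2 = p then γ p * (γ (p - 1))⁻¹
    else if d.2 = p + 1 then (γ p)⁻¹
    else (γ (d.2 - 2))⁻¹
  else if d.1 = 1 then
    if d.2 = 0 then γ p
    else if d.2 = 2 * p then (γ (2 * p))⁻¹
    else if d.2 = 2 * p + 1 then (γ (2 * p))⁻¹
    else if d.2 = 2 * p + 2 then 1
    else if d.2 % 2 = 0 then (γ (p - 1 - d.2 / 2))⁻¹ * γ (p - d.2 / 2)
    else γ (p - 1 - d.2 / 2)
  else
    if d.2 = 2 * p + 1 then 1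
    else if d.2 = 2 * p + 2 then γ (2 * p)
    else if d.2 % 2 = 1 then (γ (2 * p - 1 - d.2 / 2))⁻¹ * γ (2 * p - d.2 / 2)
    else γ (2 * p - d.2 / 2)

theorem dart_cases {p : ℕ} {Q : ℕ × ℕ → Prop} (h0 : ∀ t s, t + s + 1 = p → Q (0, t))
    (h0p : Q (0, p)) (h0p' : Q (0, p + 1)) (h0' : ∀ t s, t + s = p → Q (0, p + 2 + t))
    (h10 : Q (1, 0)) (h1 : ∀ t s, t + s + 1 = p → Q (1, 2 * s + 1))
    (h1' : ∀ t s, t + s + 2 = p → Q (1, 2 * s + 2)) (h1a : Q (1, 2 * p))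
    (h1b : Q (1, 2 * p + 1)) (h1c : Q (1, 2 * p + 2))
    (h2 : ∀ t s, t + s = p → Q (2, 2 * s)) (h2' : ∀ t s, t + s + 1 = p → Q (2, 2 * s + 1))
    (h2a : Q (2, 2 * p + 1)) (h2b : Q (2, 2 * p + 2))
    (d : ℕ × ℕ) (hd : d.1 < 3) (hd' : d.2 < 2 * p + 3) : Q d := by
  obtain ⟨a, i⟩ := d
  dsimp only at hd hd'
  interval_cases a
  · rcases lt_or_ge i p with h | h
    · exact h0 i (p - i - 1) (by omega)
    · obtain ⟨_ | _ | t, rfl⟩ := Nat.exists_eq_add_of_le h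
      · exact h0p
      · exact h0p'
      · rw [show p + (t + 1 + 1) = p + 2 + t by omega]
        exact h0' t (p - t) (by omega)
  · rcases Nat.even_or_odd' i with ⟨s, rfl | rfl⟩
    · rcases eq_or_ne s p with rfl | h
      · exact h1a
      rcases eq_or_ne s (p + 1) with rfl | h'
      · exact h1c
      rcases s with _ | s
      · exact h10
      · exact h1' (p - s - 2) s (by omega)
    · rcases eq_or_ne s p with rfl | h
      · exact h1b
      · exact h1 (p - s - 1) s (by omega)
  · rcases Nat.even_or_odd' i with ⟨s, rfl | rfl⟩
    · rcases eq_or_ne s (p + 1) with rfl | h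
      · exact h2b
      · exact h2 (p - s) s (by omega)
    · rcases eq_or_ne s p with rfl | h
      · exact h2a
      · exact h2' (p - s - 1) s (by omega)

section glue

variable {p s t : ℕ}

theorem glue_zero (h : t + s + 1 = p) : glue p (0, t) = (1, 2 * s + 1) := by
  simp [glue]; grind

theorem glue_zero_fold : glue p (0, p) = (0, p) := by
  simp [glue]

theorem glue_zero_mid : glue p (0, p + 1) = (1, 0) := by
  simp [glue]

theorem glue_zero_tail (h : t + s = p) : glue p (0, p + 2 + t) = (2, 2 * s) := by
  simp [glue]; grind

theorem glue_one_start : glue p (1, 0) = (0, p + 1) := by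
  simp [glue]

theorem glue_one_odd (h : t + s + 1 = p) : glue p (1, 2 * s + 1) = (0, t) := by
  simp [glue]; grind

theorem glue_one_one (h : 1 ≤ p) : glue p (1, 1) = (0, p - 1) :=
  glue_one_odd (s := 0) (by omega)

theorem glue_one_fold (h : t + s + 2 = p) : glue p (1, 2 * s + 2) = (1, 2 * s + 2) := by
  simp [glue]; grind

theorem glue_one_sub_two (h : 1 ≤ p) : glue p (1, 2 * p) = (2, 2 * p + 2) := by
  simp [glue]; grind

theorem glue_one_sub_one : glue p (1, 2 * p + 1) = (1, 2 * p + 1) := by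
  simp [glue]

theorem glue_one_last : glue p (1, 2 * p + 2) = (2, 2 * p + 1) := by
  simp [glue]

theorem glue_two (h : t + s = p) : glue p (2, 2 * s) = (0, p + 2 + t) := by
  simp [glue]; grind

theorem glue_two_start : glue p (2, 0) = (0, p + 2 + p) := glue_two (s := 0) (add_zero p)

theorem glue_two_fold (h : t + s + 1 = p) : glue p (2, 2 * s + 1) = (2, 2 * s + 1) := by
  simp [glue]; grind

theorem glue_two_sub_one : glue p (2, 2 * p + 1) = (1, 2 * p + 2) := by
  simp [glue]

theorem glue_two_last : glue p (2, 2 * p + 2) = (1, 2 * p) := by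
  simp [glue]

variable {H : Type*} [Group H] {γ : ℕ → H}

theorem label_zero (h : t + s + 1 = p) : label p γ (0, t) = (γ t)⁻¹ := by
  rw [label, if_pos rfl, if_pos (by dsimp only; omega)]

theorem label_zero_fold : label p γ (0, p) = γ p * (γ (p - 1))⁻¹ := by
  simp [label]

theorem label_zero_mid : label p γ (0, p + 1) = (γ p)⁻¹ := by
  simp [label]

theorem label_zero_tail : label p γ (0, p + 2 + t) = (γ (p + t))⁻¹ := by
  rw [label, if_pos rfl, if_neg (by dsimp only; omega), if_neg (by dsimp only; omega),
    if_neg (by dsimp only; omega), show p + 2 + t - 2 = p + t by omega]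

theorem label_one_start : label p γ (1, 0) = γ p := by
  simp [label]

theorem label_one_odd (h : t + s + 1 = p) : label p γ (1, 2 * s + 1) = γ t := by
  simp [label]; grind

theorem label_one_one (h : 1 ≤ p) : label p γ (1, 1) = γ (p - 1) :=
  label_one_odd (s := 0) (by omega)

theorem label_one_fold (h : t + s + 2 = p) :
    label p γ (1, 2 * s + 2) = (γ t)⁻¹ * γ (t + 1) := by
  have h1 : p - 1 - (2 * s + 2) / 2 = t := by omega
  have h2 : p - (2 * s + 2) / 2 = t + 1 := by omega
  rw [label, if_neg (by simp), if_pos rfl, if_neg (by simp), if_neg (by dsimp only; omega),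
    if_neg (by dsimp only; omega), if_neg (by dsimp only; omega), if_pos (by dsimp only; omega),
    h1, h2]

theorem label_one_sub_two (h : 1 ≤ p) : label p γ (1, 2 * p) = (γ (2 * p))⁻¹ := by
  simp [label]; grind

theorem label_one_sub_one : label p γ (1, 2 * p + 1) = (γ (2 * p))⁻¹ := by
  simp [label]

theorem label_one_last : label p γ (1, 2 * p + 2) = 1 := by
  simp [label]

theorem label_two (h : t + s = p) : label p γ (2, 2 * s) = γ (p + t) := by
  simp [label]; grind

theorem label_two_start : label p γ (2, 0) = γ (p + p) := label_two (s := 0) (add_zero p)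

theorem label_two_fold (h : t + s + 1 = p) :
    label p γ (2, 2 * s + 1) = (γ (p + t))⁻¹ * γ (p + t + 1) := by
  have h1 : 2 * p - 1 - (2 * s + 1) / 2 = p + t := by omega
  have h2 : 2 * p - (2 * s + 1) / 2 = p + t + 1 := by omega
  rw [label, if_neg (by simp), if_neg (by simp), if_neg (by dsimp only; omega),
    if_neg (by dsimp only; omega), if_pos (by dsimp only; omega), h1, h2]

theorem label_two_sub_one : label p γ (2, 2 * p + 1) = 1 := by
  simp [label]

theorem label_two_last : label p γ (2, 2 * p + 2) = γ (2 * p) := by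
  simp [label]

theorem vertex_zero (h : 1 ≤ p) : IsVertex (2 * p + 3) (glue p) (0, 0) (1, 2 * p) (2, 0) where
  fst := by
    rw [glue_zero (s := p - 1) (by omega), nextSide_of_lt (by omega)]
    congr 1
    omega
  snd := by rw [glue_one_sub_two h, nextSide_last (by omega)]
  trd := by rw [glue_two_start, nextSide_last (by omega)]

theorem vertex_one (h : t + s + 2 = p) :
    IsVertex (2 * p + 3) (glue p) (0, t + 1) (1, 2 * s + 2) (1, 2 * (s + 1) + 1) where
  fst := by rw [glue_zero (s := s) (by omega), nextSide_of_lt (by omega)]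
  snd := by rw [glue_one_fold h, nextSide_of_lt (by omega)]; rfl
  trd := by rw [glue_one_odd (t := t) (by omega), nextSide_of_lt (by omega)]

theorem vertex_two (h : 1 ≤ p) :
    IsVertex (2 * p + 3) (glue p) (0, p) (0, p + 1) (1, 1) where
  fst := by rw [glue_zero_fold, nextSide_of_lt (by omega)]
  snd := by rw [glue_zero_mid, nextSide_of_lt (by omega)]
  trd := by rw [glue_one_one h, nextSide_of_lt (by omega), Nat.sub_add_cancel h]

theorem vertex_three :
    IsVertex (2 * p + 3) (glue p) (0, p + 2) (2, 2 * p + 1) (1, 0) where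
  fst := by rw [glue_zero_tail (t := 0) (zero_add p), nextSide_of_lt (by omega)]
  snd := by rw [glue_two_sub_one, nextSide_last (by omega)]
  trd := by rw [glue_one_start, nextSide_of_lt (by omega)]

theorem vertex_four (h : t + s + 1 = p) :
    IsVertex (2 * p + 3) (glue p) (0, p + 2 + (t + 1)) (2, 2 * s + 1) (2, 2 * (s + 1)) where
  fst := by rw [glue_zero_tail (s := s) (by omega), nextSide_of_lt (by omega)]
  snd := by rw [glue_two_fold h, nextSide_of_lt (by omega)]; rfl
  trd := by rw [glue_two (t := t) (by omega), nextSide_of_lt (by omega)]; rfl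

theorem vertex_five :
    IsVertex (2 * p + 3) (glue p) (1, 2 * p + 1) (1, 2 * p + 2) (2, 2 * p + 2) where
  fst := by rw [glue_one_sub_one, nextSide_of_lt (by omega)]
  snd := by rw [glue_one_last, nextSide_of_lt (by omega)]
  trd := by rw [glue_two_last, nextSide_of_lt (by omega)]

end glue

theorem exists_vertex {p : ℕ} (hp : 1 ≤ p) {Q : ℕ × ℕ → ℕ × ℕ → ℕ × ℕ → Prop}
    (hQ : ∀ d d' d'', Q d d' d'' → Q d' d'' d) (h0 : Q (0, 0) (1, 2 * p) (2, 0))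
    (h1 : ∀ t s, t + s + 2 = p → Q (0, t + 1) (1, 2 * s + 2) (1, 2 * (s + 1) + 1))
    (h2 : Q (0, p) (0, p + 1) (1, 1)) (h3 : Q (0, p + 2) (2, 2 * p + 1) (1, 0))
    (h4 : ∀ t s, t + s + 1 = p → Q (0, p + 2 + (t + 1)) (2, 2 * s + 1) (2, 2 * (s + 1)))
    (h5 : Q (1, 2 * p + 1) (1, 2 * p + 2) (2, 2 * p + 2)) :
    ∀ d : ℕ × ℕ, d.1 < 3 → d.2 < 2 * p + 3 →
      ∃ d' d'', IsVertex (2 * p + 3) (glue p) d d' d'' ∧ Q d d' d'' := by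
  have key : ∀ d d' d'', IsVertex (2 * p + 3) (glue p) d d' d'' → Q d d' d'' →
      (∃ c' c'', IsVertex (2 * p + 3) (glue p) d c' c'' ∧ Q d c' c'') ∧
      (∃ c' c'', IsVertex (2 * p + 3) (glue p) d' c' c'' ∧ Q d' c' c'') ∧
      ∃ c' c'', IsVertex (2 * p + 3) (glue p) d'' c' c'' ∧ Q d'' c' c'' :=
    fun d d' d'' h hq => ⟨⟨d', d'', h, hq⟩, ⟨d'', d, h.rotate, hQ _ _ _ hq⟩,
      ⟨d, d', h.rotate.rotate, hQ _ _ _ (hQ _ _ _ hq)⟩⟩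
  have k0 := key _ _ _ (vertex_zero hp) h0
  have k1 := fun t s h => key _ _ _ (vertex_one h) (h1 t s h)
  have k2 := key _ _ _ (vertex_two hp) h2
  have k3 := key _ _ _ vertex_three h3
  have k4 := fun t s h => key _ _ _ (vertex_four h) (h4 t s h)
  have k5 := key _ _ _ (vertex_five (p := p)) h5
  refine dart_cases ?_ k2.1 k2.2.1 ?_ k3.2.2 ?_ ?_ k0.2.1 k5.1 k5.2.1 ?_ ?_ k3.2.1 k5.2.2
  · rintro (_ | t) s h
    · exact k0.1
    · exact (k1 t s (by omega)).1
  · rintro (_ | t) s h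
    · exact k3.1
    · exact (k4 t s (by omega)).1
  · rintro t (_ | s) h
    · exact k2.2.2
    · exact (k1 t s (by omega)).2.2
  · exact fun t s h => (k1 t s h).2.1
  · rintro t (_ | s) h
    · exact k0.2.2
    · exact (k4 t s (by omega)).2.2
  · exact fun t s h => (k4 t s h).2.1

theorem isGluing {p : ℕ} (hp : 1 ≤ p) : IsGluing (2 * p + 3) (glue p) 0 (2 * p + 2) where
  fst_lt := by
    refine dart_cases ?_ ?_ ?_ ?_ ?_ ?_ ?_ ?_ ?_ ?_ ?_ ?_ ?_ ?_
    · intro t s h; rw [glue_zero h]; norm_num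
    · rw [glue_zero_fold]; norm_num
    · rw [glue_zero_mid]; norm_num
    · intro t s h; rw [glue_zero_tail h]; norm_num
    · rw [glue_one_start]; norm_num
    · intro t s h; rw [glue_one_odd h]; norm_num
    · intro t s h; rw [glue_one_fold h]; norm_num
    · rw [glue_one_sub_two hp]; norm_num
    · rw [glue_one_sub_one]; norm_num
    · rw [glue_one_last]; norm_num
    · intro t s h; rw [glue_two h]; norm_num
    · intro t s h; rw [glue_two_fold h]; norm_num
    · rw [glue_two_sub_one]; norm_num
    · rw [glue_two_last]; norm_num
  snd_lt := by
    refine dart_cases ?_ ?_ ?_ ?_ ?_ ?_ ?_ ?_ ?_ ?_ ?_ ?_ ?_ ?_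
    · intro t s h; rw [glue_zero h]; dsimp only; omega
    · rw [glue_zero_fold]; dsimp only; omega
    · rw [glue_zero_mid]; dsimp only; omega
    · intro t s h; rw [glue_zero_tail h]; dsimp only; omega
    · rw [glue_one_start]; dsimp only; omega
    · intro t s h; rw [glue_one_odd h]; dsimp only; omega
    · intro t s h; rw [glue_one_fold h]; dsimp only; omega
    · rw [glue_one_sub_two hp]; dsimp only; omega
    · rw [glue_one_sub_one]; dsimp only; omega
    · rw [glue_one_last]; dsimp only; omega
    · intro t s h; rw [glue_two h]; dsimp only; omega
    · intro t s h; rw [glue_two_fold h]; dsimp only; omega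
    · rw [glue_two_sub_one]; dsimp only; omega
    · rw [glue_two_last]; dsimp only; omega
  invol := by
    refine dart_cases ?_ ?_ ?_ ?_ ?_ ?_ ?_ ?_ ?_ ?_ ?_ ?_ ?_ ?_
    · intro t s h; rw [glue_zero h, glue_one_odd h]
    · rw [glue_zero_fold, glue_zero_fold]
    · rw [glue_zero_mid, glue_one_start]
    · intro t s h; rw [glue_zero_tail h, glue_two h]
    · rw [glue_one_start, glue_zero_mid]
    · intro t s h; rw [glue_one_odd h, glue_zero h]
    · intro t s h; rw [glue_one_fold h, glue_one_fold h]
    · rw [glue_one_sub_two hp, glue_two_last]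
    · rw [glue_one_sub_one, glue_one_sub_one]
    · rw [glue_one_last, glue_two_sub_one]
    · intro t s h; rw [glue_two h, glue_zero_tail h]
    · intro t s h; rw [glue_two_fold h, glue_two_fold h]
    · rw [glue_two_sub_one, glue_one_last]
    · rw [glue_two_last, glue_one_sub_two hp]
  corner d h h' := by
    obtain ⟨d', d'', hd, -⟩ := exists_vertex hp (Q := fun _ _ _ => True) (fun _ _ _ h => h) trivial
      (fun _ _ _ => trivial) trivial trivial (fun _ _ _ => trivial) trivial d h h'
    exact ⟨d', d'', hd⟩
  lt := by omega
  lt' := by omega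
  fst_eq := by rw [glue_zero (s := p - 1) (by omega)]
  fst_eq' := by rw [glue_one_last]

theorem isLabelling {H : Type*} [Group H] {p : ℕ} (hp : 1 ≤ p) {γ : ℕ → H}
    (hγ : IsEvenPolygonFamily (2 * p + 1) γ) :
    IsLabelling (2 * p + 3) (glue p) 0 (2 * p + 2) (label p γ) := by
  refine .of_exists ?_ (exists_vertex hp (fun _ _ _ => mul_mul_eq_one_rotate) ?_ ?_ ?_ ?_ ?_ ?_)
    ?_ ?_
  · refine dart_cases ?_ ?_ ?_ ?_ ?_ ?_ ?_ ?_ ?_ ?_ ?_ ?_ ?_ ?_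
    · intro t s h; rw [glue_zero h, label_zero h, label_one_odd h, mul_inv_cancel]
    · have h := hγ.sq (p - 1) (by omega)
      rw [Nat.sub_add_cancel hp, mul_assoc, inv_mul_eq_one] at h
      rw [glue_zero_fold, label_zero_fold, ← mul_assoc, mul_inv_eq_one, mul_assoc, ← h]
    · rw [glue_zero_mid, label_zero_mid, label_one_start, mul_inv_cancel]
    · intro t s h; rw [glue_zero_tail h, label_zero_tail, label_two h, mul_inv_cancel]
    · rw [glue_one_start, label_zero_mid, label_one_start, inv_mul_cancel]
    · intro t s h; rw [glue_one_odd h, label_zero h, label_one_odd h, inv_mul_cancel]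
    · intro t s h; rw [glue_one_fold h, label_one_fold h, hγ.sq _ (by omega)]
    · rw [glue_one_sub_two hp, label_two_last, label_one_sub_two hp, mul_inv_cancel]
    · have h := hγ.sq (2 * p) (by omega)
      rw [hγ.last, mul_one] at h
      rw [glue_one_sub_one, label_one_sub_one, h]
    · rw [glue_one_last, label_one_last, label_two_sub_one, one_mul]
    · intro t s h; rw [glue_two h, label_zero_tail, label_two h, inv_mul_cancel]
    · intro t s h; rw [glue_two_fold h, label_two_fold h, hγ.sq _ (by omega)]
    · rw [glue_two_sub_one, label_one_last, label_two_sub_one, one_mul]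
    · rw [glue_two_last, label_two_last, label_one_sub_two hp, inv_mul_cancel]
  · rw [label_zero (s := p - 1) (by omega), label_one_sub_two hp, label_two_start, ← two_mul,
      hγ.zero, inv_one, mul_one, mul_inv_cancel]
  · intro t s h
    rw [label_zero (s := s) (by omega), label_one_fold h, label_one_odd (t := t) (by omega),
      mul_inv_cancel_right, mul_inv_cancel]
  · rw [label_zero_fold, label_zero_mid, label_one_one hp, inv_mul_cancel_left, mul_inv_cancel]
  · rw [show (0, p + 2) = (0, p + 2 + 0) from rfl, label_zero_tail, label_two_sub_one,
      label_one_start, one_mul, add_zero, mul_inv_cancel]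
  · intro t s h
    rw [label_zero_tail, label_two_fold h, label_two (t := t) (by omega), ← add_assoc,
      mul_inv_cancel_right, mul_inv_cancel]
  · rw [label_one_sub_one, label_one_last, label_two_last, one_mul, mul_inv_cancel]
  · rw [label_zero (s := p - 1) (by omega), hγ.zero, inv_one]
  · rw [label_one_last]

theorem exists_family {H : Type*} [Group H] {p : ℕ} (hp : 1 ≤ p) {E : ℕ × ℕ → H}
    (hE : IsLabelling (2 * p + 3) (glue p) 0 (2 * p + 2) E) :
    ∃ γ, IsEvenPolygonFamily (2 * p + 1) γ ∧
      ∀ d : ℕ × ℕ, d.1 < 3 → d.2 < 2 * p + 3 → label p γ d = E d := by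
  have c0 := hE.corner _ _ _ (by norm_num) (by norm_num) (vertex_zero hp)
  have c1 := fun t s h => hE.corner _ _ _ (by norm_num) (by simp; omega)
    (vertex_one (p := p) (t := t) (s := s) h)
  have c2 := hE.corner _ _ _ (by norm_num) (by simp; omega) (vertex_two hp)
  have c3 := hE.corner _ _ _ (by norm_num) (by simp; omega) (vertex_three (p := p))
  have c4 := fun t s h => hE.corner _ _ _ (by norm_num) (by simp; omega)
    (vertex_four (p := p) (t := t) (s := s) h)
  have c5 := hE.corner _ _ _ (by norm_num) (by simp) (vertex_five (p := p))
  obtain ⟨γ, hγ⟩ : ∃ γ : ℕ → H, γ = fun i =>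
      if i < p then E (1, 2 * (p - 1 - i) + 1) else if i ≤ 2 * p then E (2, 2 * (2 * p - i))
      else 1 := ⟨_, rfl⟩
  have e2b : E (2, 2 * p + 1) = 1 := by
    have h := hE.inv (1, 2 * p + 2) (by norm_num) (by simp)
    rwa [glue_one_last, hE.eq_one', mul_one] at h
  have e0 : ∀ t s, t + s + 1 = p → E (0, t) = (E (1, 2 * s + 1))⁻¹ := fun t s h => by
    have h1 := hE.inv (1, 2 * s + 1) (by norm_num) (by simp; omega)
    rw [glue_one_odd h] at h1
    exact eq_inv_of_mul_eq_one_left h1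
  have e0m : E (0, p + 1) = (E (1, 0))⁻¹ := by
    have h1 := hE.inv (1, 0) (by norm_num) (by simp)
    rw [glue_one_start] at h1
    exact eq_inv_of_mul_eq_one_left h1
  have e0' : ∀ t s, t + s = p → E (0, p + 2 + t) = (E (2, 2 * s))⁻¹ := fun t s h => by
    have h1 := hE.inv (2, 2 * s) (by norm_num) (by simp; omega)
    rw [glue_two h] at h1
    exact eq_inv_of_mul_eq_one_left h1
  have g1 : ∀ t s, t + s + 1 = p → γ t = E (1, 2 * s + 1) := fun t s h => by
    rw [hγ]
    dsimp only
    rw [if_pos (by omega), show p - 1 - t = s by omega]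
  have g2 : ∀ t s, t + s = p → γ (p + t) = E (2, 2 * s) := fun t s h => by
    rw [hγ]
    dsimp only
    rw [if_neg (by omega), if_pos (by omega), show 2 * p - (p + t) = s by omega]
  have gp : γ p = E (1, 0) := by
    rw [show (0, p + 2) = (0, p + 2 + 0) from rfl, e2b, one_mul, e0' 0 p (zero_add p),
      ← g2 0 p (zero_add p), add_zero] at c3
    exact (mul_inv_eq_one.1 c3).symm
  have g0 : γ 0 = 1 := by
    rw [g1 0 (p - 1) (by omega), ← inv_inj, ← e0 0 (p - 1) (by omega), hE.eq_one, inv_one]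
  have gl : γ (2 * p + 1) = 1 := by
    rw [hγ]
    dsimp only
    rw [if_neg (by omega), if_neg (by omega)]
  have e1a : E (1, 2 * p) = (γ (2 * p))⁻¹ := by
    rw [hE.eq_one, mul_one] at c0
    rw [two_mul p, g2 p 0 (add_zero p), ← two_mul]
    exact eq_inv_of_mul_eq_one_right c0
  have e2c : E (2, 2 * p + 2) = γ (2 * p) := by
    have h1 := hE.inv (1, 2 * p) (by norm_num) (by simp)
    rw [glue_one_sub_two hp, e1a] at h1
    exact mul_inv_eq_one.1 h1
  have e1b : E (1, 2 * p + 1) = (γ (2 * p))⁻¹ := by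
    rw [hE.eq_one', one_mul, e2c] at c5
    exact eq_inv_of_mul_eq_one_right c5
  have ep : E (0, p) = γ p * (γ (p - 1))⁻¹ := by
    have h1 := g1 (p - 1) 0 (by omega)
    rw [mul_zero, zero_add] at h1
    rw [e0m, ← gp, ← h1, ← mul_assoc] at c2
    rw [eq_inv_of_mul_eq_one_right c2, mul_inv_rev, inv_inv]
  have f1 : ∀ t s, t + s + 2 = p → (γ t)⁻¹ * γ (t + 1) = E (1, 2 * s + 2) := fun t s h => by
    have h1 := c1 t s h
    rw [e0 (t + 1) s (by omega), ← g1 t _ (by omega), ← g1 (t + 1) _ (by omega)] at h1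
    rw [← eq_inv_of_mul_eq_one_right h1, inv_mul_cancel_right]
  have f2 : ∀ t s, t + s + 1 = p → (γ (p + t))⁻¹ * γ (p + t + 1) = E (2, 2 * s + 1) :=
    fun t s h => by
    have h1 := c4 t s h
    rw [e0' (t + 1) s (by omega), ← g2 t _ (by omega), ← g2 (t + 1) _ (by omega)] at h1
    rw [← eq_inv_of_mul_eq_one_right h1, ← add_assoc, inv_mul_cancel_right]
  refine ⟨γ, ⟨g0, gl, ?_⟩, dart_cases ?_ ?_ ?_ ?_ ?_ ?_ ?_ ?_ ?_ ?_ ?_ ?_ ?_ ?_⟩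
  · intro i hi
    rcases lt_or_ge (i + 1) p with h | h
    · obtain ⟨s, hs⟩ := Nat.exists_eq_add_of_lt h
      rw [f1 i s (by omega)]
      have h1 := hE.inv (1, 2 * s + 2) (by norm_num) (by simp; omega)
      rwa [glue_one_fold (t := i) (by omega)] at h1
    rcases lt_or_ge i p with h' | h'
    · obtain rfl : i + 1 = p := by omega
      have h1 := hE.inv (0, i + 1) (by norm_num) (by simp; omega)
      rw [glue_zero_fold, ep, Nat.add_sub_cancel, ← mul_assoc, mul_inv_eq_one, mul_assoc] at h1
      rw [mul_assoc, h1, inv_mul_cancel]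
    · obtain ⟨t, rfl⟩ := Nat.exists_eq_add_of_le h'
      rcases lt_or_ge t p with h'' | h''
      · obtain ⟨s, hs⟩ := Nat.exists_eq_add_of_lt h''
        rw [f2 t s hs.symm]
        have h1 := hE.inv (2, 2 * s + 1) (by norm_num) (by simp; omega)
        rwa [glue_two_fold hs.symm] at h1
      · obtain rfl : t = p := by omega
        have h1 := hE.inv (1, 2 * t + 1) (by norm_num) (by simp)
        rw [glue_one_sub_one, e1b] at h1
        rw [← two_mul, gl, mul_one, h1]
  · intro t s h; rw [label_zero h, e0 t s h, g1 t s h]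
  · rw [label_zero_fold, ep]
  · rw [label_zero_mid, e0m, gp]
  · intro t s h; rw [label_zero_tail, e0' t s h, g2 t s h]
  · rw [label_one_start, gp]
  · intro t s h; rw [label_one_odd h, g1 t s h]
  · intro t s h; rw [label_one_fold h, f1 t s h]
  · rw [label_one_sub_two hp, e1a]
  · rw [label_one_sub_one, e1b]
  · rw [label_one_last, hE.eq_one']
  · intro t s h; rw [label_two h, g2 t s h]
  · intro t s h; rw [label_two_fold h, f2 t s h]
  · rw [label_two_sub_one, e2b]
  · rw [label_two_last, e2c]

theorem map_label {G H : Type*} [Group G] [Group H] {p : ℕ} (hp : 1 ≤ p) {γ : ℕ → G} {γ' : ℕ → H}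
    {ψ : G →* H} (hψ : ∀ i ≤ 2 * p + 1, ψ (γ i) = γ' i) :
    ∀ d : ℕ × ℕ, d.1 < 3 → d.2 < 2 * p + 3 → ψ (label p γ d) = label p γ' d := by
  refine dart_cases ?_ ?_ ?_ ?_ ?_ ?_ ?_ ?_ ?_ ?_ ?_ ?_ ?_ ?_
  · intro t s h
    rw [label_zero h, label_zero h, map_inv, hψ _ (by omega)]
  · rw [label_zero_fold, label_zero_fold, map_mul, map_inv, hψ _ (by omega), hψ _ (by omega)]
  · rw [label_zero_mid, label_zero_mid, map_inv, hψ _ (by omega)]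
  · intro t s h
    rw [label_zero_tail, label_zero_tail, map_inv, hψ _ (by omega)]
  · rw [label_one_start, label_one_start, hψ _ (by omega)]
  · intro t s h
    rw [label_one_odd h, label_one_odd h, hψ _ (by omega)]
  · intro t s h
    rw [label_one_fold h, label_one_fold h, map_mul, map_inv, hψ _ (by omega), hψ _ (by omega)]
  · rw [label_one_sub_two hp, label_one_sub_two hp, map_inv, hψ _ (by omega)]
  · rw [label_one_sub_one, label_one_sub_one, map_inv, hψ _ (by omega)]
  · rw [label_one_last, label_one_last, map_one]
  · intro t s h
    rw [label_two h, label_two h, hψ _ (by omega)]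
  · intro t s h
    rw [label_two_fold h, label_two_fold h, map_mul, map_inv, hψ _ (by omega), hψ _ (by omega)]
  · rw [label_two_sub_one, label_two_sub_one, map_one]
  · rw [label_two_last, label_two_last, hψ _ (by omega)]

theorem commensurable {p : ℕ} (hp : 1 ≤ p) {N : Fin 3 → Fin 3 → ℕ}
    (hsymm : ∀ i j, N i j = N j i) (h01 : N 0 1 = 2 * p + 3) (h12 : N 1 2 = 3)
    (h02 : N 0 2 = 2) :
    AbstractlyCommensurable (EvenGroup N 0) (EvenPolygonGroup (2 * p + 1)) := by
  refine EvenGroup.commensurable_of_gluing hsymm h01 h12 h02 (isGluing hp)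
    (isLabelling hp EvenPolygonGroup.isEvenPolygonFamily) ?_ fun E hE => ?_
  · rw [eq_top_iff, ← EvenPolygonGroup.closure_of]
    refine Subgroup.closure_mono ?_
    rintro _ ⟨i, hi, rfl⟩
    rw [Set.mem_Iio] at hi
    rcases lt_or_ge i p with h | h
    · obtain ⟨s, hs⟩ := Nat.exists_eq_add_of_lt h
      exact ⟨(1, 2 * s + 1), ⟨by norm_num, by dsimp only; omega⟩, label_one_odd hs.symm⟩
    · obtain ⟨t, rfl⟩ := Nat.exists_eq_add_of_le h
      obtain ⟨s, hs⟩ := Nat.exists_eq_add_of_le (show t ≤ p by omega)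
      exact ⟨(2, 2 * s), ⟨by norm_num, by dsimp only; omega⟩, label_two hs.symm⟩
  · obtain ⟨γ, hγ, hγE⟩ := exists_family hp hE
    obtain ⟨ψ, hψ⟩ := EvenPolygonGroup.exists_hom hγ
    exact ⟨ψ, fun d h h' => (map_label hp hψ d h h').trans (hγE d h h')⟩

end OddGluing

/-- For all `m ≥ 5` and `m' ≥ 7`, the groups `⧈(m,2)` and `Δ(m',2)` are abstractly
commensurable. -/
theorem cubeGroup_simplexGroup_dim_two_commensurable (m m' : ℕ) (hm : 5 ≤ m) (hm' : 7 ≤ m') :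
    AbstractlyCommensurable (cubeGroup m 2 (by omega)) (simplexGroup m' 2 (by omega)) := by
  have : NeZero m := ⟨by omega⟩
  have pentagon : ∀ n, 5 ≤ n → AbstractlyCommensurable (PolygonGroup 5) (PolygonGroup n) :=
    fun n hn => by
      obtain ⟨k, rfl⟩ := Nat.exists_eq_add_of_le' hn
      exact PolygonGroup.commensurable_pentagon k
  have cube : AbstractlyCommensurable (cubeGroup m 2 (by omega)) (PolygonGroup m) :=
    PolygonGroup.commensurable_triangleGroup (fun i j => cubeMatrix m 2 (by omega) i j)
      (CoxeterMatrix.diagonal _) (CoxeterMatrix.symmetric _) rfl rfl rfl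
  have simplex : AbstractlyCommensurable (simplexGroup m' 2 (by omega))
      (EvenGroup (fun i j => simplexMatrix m' 2 (by omega) i j) 0) :=
    ReflectionGroup.commensurable_evenGroup (fun i j => simplexMatrix m' 2 (by omega) i j) 0
      (CoxeterMatrix.diagonal _)
  have gluing : AbstractlyCommensurable
      (EvenGroup (fun i j => simplexMatrix m' 2 (by omega) i j) 0) (EvenPolygonGroup (m' - 2)) := by
    obtain ⟨p, rfl | rfl⟩ := Nat.even_or_odd' m'
    · obtain ⟨p, rfl⟩ := Nat.exists_eq_add_of_le' (show 1 ≤ p by omega)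
      exact EvenGluing.commensurable (CoxeterMatrix.symmetric _) rfl rfl rfl
    · obtain ⟨p, rfl⟩ := Nat.exists_eq_add_of_le' (show 1 ≤ p by omega)
      exact OddGluing.commensurable (p := p) (by omega) (CoxeterMatrix.symmetric _) rfl rfl rfl
  have even : AbstractlyCommensurable (PolygonGroup (m' - 2)) (EvenPolygonGroup (m' - 2)) :=
    ReflectionGroup.commensurable_evenGroup _ 0 (polygonMatrix_self _)
  exact cube.trans <| (pentagon m hm).symm.trans <| (pentagon (m' - 2) (by omega)).trans <|
    even.trans <| gluing.symm.trans simplex.symm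
end

section
/- Let d ≥ 2. For i, i' ∈ ZMod d and natural numbers k, k' with 1 ≤ k ≤ d−1 and 1 ≤ k' ≤ d−1, if the cyclic intervals {i, i+1, …, i+k−1} and {i', i'+1, …, i'+k'−1} are equal as subsets of ZMod d, then i = i' and k = k'. Consequently, for any fixed vertex u of the d-dimensional hypercube, the d cyclic lattice paths from u with starting directions 0, 1, …, d−1 are pairwise internally vertex-disjoint: the vertices u + χ(i,k) for i ∈ ZMod d and 0 < k < d are pairwise distinct as (i,k) varies. -/
open Classical in
/-- The indicator function (with values in `ZMod 2`) of the cyclic interval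
`{i, i+1, …, i+k-1}` in `ZMod d`. -/
noncomputable def cyclicIndicator (d : ℕ) (i : ZMod d) (k : ℕ) : ZMod d → ZMod 2 :=
  fun j => if ∃ t : ℕ, t < k ∧ j = i + (t : ZMod d) then 1 else 0

/-- A cyclic interval of length less than `d` does not contain the predecessor of its start. -/
theorem sub_one_not_mem_cyclicInterval {d k : ℕ} (hk : k < d) (i : ZMod d) :
    ¬ ∃ t : ℕ, t < k ∧ i - 1 = i + (t : ZMod d) := by
  rintro ⟨t, ht, h⟩
  have h0 : ((t + 1 : ℕ) : ZMod d) = 0 := by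
    push_cast
    linear_combination -h
  have := Nat.le_of_dvd t.succ_pos ((ZMod.natCast_eq_zero_iff _ _).1 h0)
  omega

/-- A point of a cyclic interval whose predecessor lies outside is the starting point. -/
theorem eq_start_of_sub_one_not_mem_cyclicInterval {d k : ℕ} {i j : ZMod d}
    (hj : ∃ t : ℕ, t < k ∧ j = i + (t : ZMod d))
    (hpred : ¬ ∃ t : ℕ, t < k ∧ j - 1 = i + (t : ZMod d)) : j = i := by
  obtain ⟨t, ht, rfl⟩ := hj
  cases t with
  | zero => simp
  | succ s =>
    refine absurd ⟨s, by omega, ?_⟩ hpred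
    push_cast
    ring

/-- Among cyclic intervals with a common start, inclusion bounds the length. -/
theorem length_le_of_cyclicInterval_subset {d k k' : ℕ} (hk' : k' ≤ d) {i : ZMod d}
    (h : ∀ j : ZMod d, (∃ t : ℕ, t < k' ∧ j = i + (t : ZMod d)) →
      ∃ t : ℕ, t < k ∧ j = i + (t : ZMod d)) : k' ≤ k := by
  by_contra! hlt
  obtain ⟨t, ht, hkt⟩ := h (i + k) ⟨k, hlt, rfl⟩
  have hmod := (ZMod.natCast_eq_natCast_iff' _ _ _).1 (add_left_cancel hkt)
  rw [Nat.mod_eq_of_lt (by omega), Nat.mod_eq_of_lt (by omega)] at hmod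
  omega

/-- Proper nonempty cyclic intervals determine their start and length. -/
theorem cyclicInterval_injective {d k k' : ℕ} {i i' : ZMod d}
    (hk : 0 < k) (hkd : k < d) (hkd' : k' < d)
    (h : ∀ j : ZMod d, (∃ t : ℕ, t < k ∧ j = i + (t : ZMod d)) ↔
      ∃ t : ℕ, t < k' ∧ j = i' + (t : ZMod d)) : i = i' ∧ k = k' := by
  have hi : i = i' := eq_start_of_sub_one_not_mem_cyclicInterval
    ((h i).1 ⟨0, hk, by simp⟩)
    (fun hmem => sub_one_not_mem_cyclicInterval hkd i ((h (i - 1)).2 hmem))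
  subst hi
  exact ⟨rfl, le_antisymm
    (length_le_of_cyclicInterval_subset hkd.le fun j => (h j).1)
    (length_le_of_cyclicInterval_subset hkd'.le fun j => (h j).2)⟩

/-- Equal cyclic indicators have the same supporting cyclic interval. -/
theorem mem_cyclicInterval_iff_of_cyclicIndicator_eq {d k k' : ℕ} {i i' : ZMod d}
    (h : cyclicIndicator d i k = cyclicIndicator d i' k') (j : ZMod d) :
    (∃ t : ℕ, t < k ∧ j = i + (t : ZMod d)) ↔
      ∃ t : ℕ, t < k' ∧ j = i' + (t : ZMod d) := by
  have hj := congrFun h j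
  unfold cyclicIndicator at hj
  split_ifs at hj with h₁ h₂ h₂
  · exact iff_of_true h₁ h₂
  · exact absurd hj one_ne_zero
  · exact absurd hj zero_ne_one
  · exact iff_of_false h₁ h₂

/-- Proper nonempty cyclic intervals in `ZMod d` determine their starting point and their
length; consequently, for any fixed vertex `u` of the `d`-dimensional hypercube
(vertices being functions `ZMod d → ZMod 2`), the interior vertices `u + χ(i,k)`
(`0 < k < d`) of the `d` cyclic lattice paths from `u` are pairwise distinct. -/
theorem cyclic_paths_internally_disjoint (d : ℕ) (hd : 2 ≤ d) :
    (∀ (i i' : ZMod d) (k k' : ℕ), 1 ≤ k → k ≤ d - 1 → 1 ≤ k' → k' ≤ d - 1 →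
      {j : ZMod d | ∃ t : ℕ, t < k ∧ j = i + (t : ZMod d)} =
        {j : ZMod d | ∃ t : ℕ, t < k' ∧ j = i' + (t : ZMod d)} →
      i = i' ∧ k = k') ∧
    (∀ (u : ZMod d → ZMod 2) (i i' : ZMod d) (k k' : ℕ),
      0 < k → k < d → 0 < k' → k' < d →
      u + cyclicIndicator d i k = u + cyclicIndicator d i' k' →
      i = i' ∧ k = k') := by
  constructor
  · intro i i' k k' hk hkd _ hkd' h
    exact cyclicInterval_injective hk (by omega) (by omega) (Set.ext_iff.1 h)
  · intro u i i' k k' hk hkd _ hkd' h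
    exact cyclicInterval_injective hk hkd hkd'
      (mem_cyclicInterval_iff_of_cyclicIndicator_eq (add_left_cancel h))
end

section
/- Let d ≥ 2 and fix a vertex u of the d-dimensional hypercube. The map sending a pair (i,k), with i ∈ ZMod d and k a natural number with 0 ≤ k ≤ d−1, to the directed edge with source vertex u + χ(i,k) and flipped coordinate i + k, is injective. In particular, the d cyclic lattice paths from u with starting directions 0, 1, …, d−1 are pairwise edge-disjoint, and together they traverse exactly d² distinct directed edges of the hypercube. -/
theorem cyclicIndicator_eq_one_iff {d : ℕ} {i : ZMod d} {k : ℕ} {j : ZMod d} :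
    cyclicIndicator d i k j = 1 ↔ ∃ t : ℕ, t < k ∧ j = i + (t : ZMod d) := by
  simp [cyclicIndicator]

/-- Two cyclic intervals of length less than `d` with the same end and the same indicator function
have the same length; this is one of the two inequalities. -/
theorem le_of_cyclicIndicator_eq {d : ℕ} {i j : ZMod d} {k l : ℕ} (hl : l < d)
    (hind : cyclicIndicator d i k = cyclicIndicator d j l)
    (hend : i + (k : ZMod d) = j + (l : ZMod d)) : l ≤ k := by
  by_contra! hkl
  have hj : cyclicIndicator d j l j = 1 :=
    cyclicIndicator_eq_one_iff.2 ⟨0, by lia, by simp⟩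
  rw [← hind, cyclicIndicator_eq_one_iff] at hj
  obtain ⟨t, htk, rfl⟩ := hj
  have hcast : ((t + l - k : ℕ) : ZMod d) = 0 := by
    rw [Nat.cast_sub (by lia), Nat.cast_add, sub_eq_zero]
    rw [add_assoc] at hend
    exact (add_left_cancel hend).symm
  have := Nat.le_of_dvd (by lia) ((ZMod.natCast_eq_zero_iff _ _).1 hcast)
  lia

/-- For a fixed vertex `u` of the `d`-dimensional hypercube, the map sending a pair `(i,k)`
(`i ∈ ZMod d`, `0 ≤ k ≤ d-1`) to the directed edge with source `u + χ(i,k)` and flipped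
coordinate `i + k` is injective; in particular the `d` cyclic lattice paths from `u` are
pairwise edge-disjoint and traverse exactly `d²` distinct directed edges. -/
theorem cyclic_paths_edge_disjoint (d : ℕ) (hd : 2 ≤ d) (u : ZMod d → ZMod 2) :
    Function.Injective (fun p : ZMod d × Fin d =>
      (u + cyclicIndicator d p.1 p.2.val, p.1 + (p.2.val : ZMod d))) ∧
    (Set.range fun p : ZMod d × Fin d =>
      (u + cyclicIndicator d p.1 p.2.val, p.1 + (p.2.val : ZMod d))).ncard = d ^ 2 := by
  have hinj : Function.Injective (fun p : ZMod d × Fin d =>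
      (u + cyclicIndicator d p.1 p.2.val, p.1 + (p.2.val : ZMod d))) := by
    rintro ⟨i, k⟩ ⟨j, l⟩ h
    obtain ⟨hsource, hend⟩ := Prod.mk.inj h
    have hind := add_left_cancel hsource
    have hkl : k = l := Fin.ext <| le_antisymm
      (le_of_cyclicIndicator_eq k.isLt hind.symm hend.symm)
      (le_of_cyclicIndicator_eq l.isLt hind hend)
    subst hkl
    exact Prod.ext (add_right_cancel hend) rfl
  refine ⟨hinj, ?_⟩
  rw [← Set.image_univ, Set.ncard_image_of_injective _ hinj, Set.ncard_univ, Nat.card_prod,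
    Nat.card_zmod, Nat.card_fin, sq]
end

section
/- Let d ≥ 2. For every vertex w : ZMod d → ZMod 2 of the d-dimensional hypercube and every coordinate a ∈ ZMod d, there are exactly d triples (u, i, k), with u : ZMod d → ZMod 2, i ∈ ZMod d, and k a natural number with 0 ≤ k ≤ d−1, such that i + k = a and u + χ(i,k) = w. In other words, each directed edge of the hypercube is traversed exactly d times in total among all cyclic lattice paths from all vertices. -/
/-- Every directed edge of the `d`-dimensional hypercube, specified by its source vertex `w`
and the coordinate `a` it flips, is traversed exactly `d` times among all the cyclic lattice
paths from all vertices: there are exactly `d` triples `(u, i, k)` with `0 ≤ k ≤ d-1`,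
`i + k = a` and `u + χ(i,k) = w`. -/
theorem cyclic_paths_cover_each_edge_d_times (d : ℕ) (hd : 2 ≤ d)
    (w : ZMod d → ZMod 2) (a : ZMod d) :
    {t : (ZMod d → ZMod 2) × ZMod d × Fin d |
      t.2.1 + (t.2.2.val : ZMod d) = a ∧
        t.1 + cyclicIndicator d t.2.1 t.2.2.val = w}.ncard = d := by
  have range_eq : {t : (ZMod d → ZMod 2) × ZMod d × Fin d |
      t.2.1 + (t.2.2.val : ZMod d) = a ∧
        t.1 + cyclicIndicator d t.2.1 t.2.2.val = w} =
      Set.range fun k : Fin d =>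
        (w - cyclicIndicator d (a - (k.val : ZMod d)) k.val, a - (k.val : ZMod d), k) := by
    ext ⟨u, i, k⟩
    simp only [Set.mem_ofPred_eq, Set.mem_range, Prod.mk.injEq]
    constructor
    · rintro ⟨rfl, rfl⟩
      exact ⟨k, by simp, by simp, rfl⟩
    · rintro ⟨k, rfl, rfl, rfl⟩
      simp
  rw [range_eq, Set.ncard_range_of_injective fun k l h => congrArg (fun t => t.2.2) h,
    Nat.card_fin]
end
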